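/- Let F be a field of characteristic p > 2, let α be a partition of n and β a one-box-shift of α with β_a = α_a − 1 and β_b = α_b + 1 for a < b, and let θ̂ : S^α → S^β be an FΣ_n-homomorphism with coefficients Λ as above. Let {N} be a removable α-set of type β, let i ∈ {N}, and let j = N̂(i) be such that (i, α_i) and (j, α_j) are adjacent removable nodes of [α]. Then h_i Λ_{{N}} + Λ_{{N}∖{i}} = h_j Λ_{{N}} + Λ_{{N}∖{j}}, where the term Λ_{{N}∖{i}} is omitted if i = a and the term Λ_{{N}∖{j}} is omitted if i = b−1 (so j = b, and h_b = 0). -/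

import Mathlib

namespace CarterPayne

open Finset

/-- A partition of `n`, presented by its parts function; rows are indexed from `1`. -/
structure Partition (n : ℕ) where
  parts : ℕ → ℕ
  parts_zero : parts 0 = 0
  antitone : ∀ ⦃i j : ℕ⦄, 0 < i → i ≤ j → parts j ≤ parts i
  finite_support : (Function.support parts).Finite
  sum_parts : ∑ᶠ i, parts i = n

variable {n : ℕ}

/-- The set of cells `(row, column)` (both 1-indexed) of the Young diagram of `μ`. -/
def Partition.cells (μ : Partition n) : Set (ℕ × ℕ) :=
  {c | 0 < c.1 ∧ 0 < c.2 ∧ c.2 ≤ μ.parts c.1}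

/-- A tabloid for the composition `c` of `n`: an assignment of the `n` symbols to rows
(rows indexed from 1), row `i` receiving exactly `c i` symbols. -/
def Tabloid (n : ℕ) (c : ℕ → ℕ) : Type :=
  {g : Fin n → ℕ // ∀ i, (Finset.univ.filter fun k => g k = i).card = c i}

/-- The permutation module `M^c` over `R`: the free `R`-module on the set of tabloids. -/
abbrev PermMod (R : Type*) [CommRing R] (n : ℕ) (c : ℕ → ℕ) := Tabloid n c →₀ R

/-- The action of a permutation of the symbols on tabloids. -/
def permTabloid (c : ℕ → ℕ) (π : Equiv.Perm (Fin n)) (f : Tabloid n c) : Tabloid n c :=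
  ⟨fun k => f.1 (π.symm k), fun i => by
    rw [← f.2 i]
    exact Finset.card_equiv π.symm fun a => by simp⟩

/-- The `R`-linear action of a permutation of the symbols on `M^c`. -/
noncomputable def permM (R : Type*) [CommRing R] (c : ℕ → ℕ) (π : Equiv.Perm (Fin n)) :
    PermMod R n c →ₗ[R] PermMod R n c :=
  Finsupp.lmapDomain R R (permTabloid c π)

/-- A bijective `μ`-tableau, presented by the placement map which sends each of the
`n` symbols to the cell of the Young diagram containing it. -/
structure Placement (μ : Partition n) where
  pos : Fin n → ℕ × ℕ
  mem : ∀ k, pos k ∈ μ.cells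
  inj : Function.Injective pos
  surj : ∀ c ∈ μ.cells, ∃ k, pos k = c

/-- The column stabilizer of a bijective tableau, as a set of permutations of the symbols. -/
def colStab {μ : Partition n} (T : Placement μ) : Finset (Equiv.Perm (Fin n)) :=
  Finset.univ.filter fun π => ∀ k, (T.pos (π k)).2 = (T.pos k).2

lemma rowFiber_card {μ : Partition n} (T : Placement μ) (i : ℕ) :
    (Finset.univ.filter fun k => (T.pos k).1 = i).card = μ.parts i := by
  classical
  have h : (Finset.univ.filter fun k => (T.pos k).1 = i).card
      = (Finset.Icc 1 (μ.parts i)).card := by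
    apply Finset.card_bij (fun k _ => (T.pos k).2)
    · intro a ha
      simp only [Finset.mem_filter, Finset.mem_univ, true_and] at ha
      obtain ⟨h1, h2, h3⟩ := T.mem a
      exact Finset.mem_Icc.mpr ⟨h2, ha ▸ h3⟩
    · intro a ha b hb hab
      simp only [Finset.mem_filter, Finset.mem_univ, true_and] at ha hb
      exact T.inj (Prod.ext (ha.trans hb.symm) hab)
    · intro j hj
      rw [Finset.mem_Icc] at hj
      have hi0 : 0 < i := by
        rcases Nat.eq_zero_or_pos i with h0 | h0
        · exfalso; rw [h0, μ.parts_zero] at hj; omega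
        · exact h0
      obtain ⟨k, hk⟩ := T.surj (i, j) ⟨hi0, hj.1, hj.2⟩
      exact ⟨k, by simp [hk], by simp [hk]⟩
  rw [h, Nat.card_Icc]
  omega

/-- The row tabloid `{tπ}` associated to the bijective tableau `tπ`. -/
def rowTabloid {μ : Partition n} (T : Placement μ) (π : Equiv.Perm (Fin n)) :
    Tabloid n μ.parts :=
  ⟨fun k => (T.pos (π k)).1, fun i => by
    rw [← rowFiber_card T i]
    exact Finset.card_equiv π fun a => by simp⟩

/-- The polytabloid `e_t` attached to a bijective tableau `t`. -/
noncomputable def polytabloid (R : Type*) [CommRing R] {μ : Partition n} (T : Placement μ) :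
    PermMod R n μ.parts :=
  ∑ π ∈ colStab T, ((Equiv.Perm.sign π : ℤ) : R) • Finsupp.single (rowTabloid T π) (1 : R)

/-- The Specht module `S^μ`, the span in `M^μ` of all polytabloids. -/
noncomputable def Specht (R : Type*) [CommRing R] (μ : Partition n) :
    Submodule R (PermMod R n μ.parts) :=
  Submodule.span R (Set.range fun T : Placement μ => polytabloid R T)

/-- `β` is obtained from the partition `α` of `n` by moving one box from
(the end of) row `a` to (the end of) row `b`; i.e. `β` is a one-box-shift of `α`. -/
structure OneBoxShift {n : ℕ} (α β : Partition n) (a b : ℕ) : Prop where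
  a_pos : 0 < a
  a_lt_b : a < b
  rem : α.parts (a + 1) < α.parts a
  add : α.parts b < α.parts (b - 1)
  at_a : β.parts a = α.parts a - 1
  at_b : β.parts b = α.parts b + 1
  elsewhere : ∀ i, i ≠ a → i ≠ b → β.parts i = α.parts i

/-- The space of `RΣ_n`-homomorphisms from `S^α` to `M^c` whose image lies in the
submodule `target` of `M^c`; an `R`-linear map is an `RΣ_n`-homomorphism when it
intertwines the permutation actions on source and target. -/
noncomputable def SpechtHom (R : Type*) [CommRing R] (α : Partition n) (c : ℕ → ℕ)
    (target : Submodule R (PermMod R n c)) :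
    Submodule R (↥(Specht R α) →ₗ[R] PermMod R n c) where
  carrier := {f | (∀ x, f x ∈ target) ∧
    ∀ (π : Equiv.Perm (Fin n)) (x y : ↥(Specht R α)),
      (x : PermMod R n α.parts) = permM R α.parts π (y : PermMod R n α.parts) →
      f x = permM R c π (f y)}
  add_mem' := by
    rintro f g ⟨hf1, hf2⟩ ⟨hg1, hg2⟩
    refine ⟨fun x => target.add_mem (hf1 x) (hg1 x), fun π x y hxy => ?_⟩
    simp only [LinearMap.add_apply, hf2 π x y hxy, hg2 π x y hxy, map_add]
  zero_mem' :=
    ⟨fun _ => target.zero_mem, fun π x y _ => by simp⟩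
  smul_mem' := by
    rintro r f ⟨hf1, hf2⟩
    refine ⟨fun x => target.smul_mem r (hf1 x), fun π x y hxy => ?_⟩
    simp only [LinearMap.smul_apply, hf2 π x y hxy, map_smul]

-- finiteness of the set of tabloids
lemma tabloid_finite (n : ℕ) (c : ℕ → ℕ) :
    {g : Fin n → ℕ | ∀ i, (Finset.univ.filter fun k => g k = i).card = c i}.Finite := by
  classical
  rcases Set.eq_empty_or_nonempty
      {g : Fin n → ℕ | ∀ i, (Finset.univ.filter fun k => g k = i).card = c i} with h | ⟨g₀, hg₀⟩
  · rw [h]; exact Set.finite_empty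
  · apply Set.Finite.subset (Set.Finite.pi fun _ : Fin n => Set.finite_range g₀)
    intro g hg
    simp only [Set.mem_pi, Set.mem_univ, forall_true_left]
    intro k
    have h1 : (Finset.univ.filter fun k' => g k' = g k).card = c (g k) := hg (g k)
    have h2 : (Finset.univ.filter fun k' => g₀ k' = g k).card = c (g k) := hg₀ (g k)
    have hp : 0 < c (g k) := by
      rw [← h1]
      exact Finset.card_pos.mpr ⟨k, by simp⟩
    rw [← h2] at hp
    obtain ⟨k', hk'⟩ := Finset.card_pos.mp hp
    simp only [Finset.mem_filter] at hk'
    exact ⟨k', hk'.2⟩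

noncomputable instance (c : ℕ → ℕ) : Fintype (Tabloid n c) :=
  (tabloid_finite n c).fintype

lemma cells_finite (μ : Partition n) : μ.cells.Finite := by
  apply Set.Finite.subset (μ.finite_support.prod (Set.finite_Icc 1 (μ.parts 1)))
  rintro ⟨i, j⟩ ⟨h1, h2, h3⟩
  refine Set.mem_prod.mpr ⟨?_, ?_⟩
  · simp only [Function.mem_support]
    intro h0
    rw [h0] at h3; omega
  · exact ⟨h2, le_trans h3 (μ.antitone Nat.one_pos h1)⟩

/-- The finset of cells of the Young diagram of `μ`. -/
noncomputable def cellFinset (μ : Partition n) : Finset (ℕ × ℕ) := (cells_finite μ).toFinset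

/-- An `α`-tableau (a filling of the diagram of `α` by natural numbers) has type `c`
if the entry `j` appears exactly `c j` times. -/
def IsTypeOf (α : Partition n) (c : ℕ → ℕ) (T : ℕ × ℕ → ℕ) : Prop :=
  ∀ j, ((cellFinset α).filter fun cc => T cc = j).card = c j

/-- A filling of the diagram of `α` is semistandard if its entries are nondecreasing
along rows and strictly increasing down columns. -/
def IsSemistandard (α : Partition n) (T : ℕ × ℕ → ℕ) : Prop :=
  (∀ i j j', (i, j) ∈ α.cells → (i, j') ∈ α.cells → j ≤ j' → T (i, j) ≤ T (i, j')) ∧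
  (∀ i i' j, (i, j) ∈ α.cells → (i', j) ∈ α.cells → i < i' → T (i, j) < T (i', j))

/-- Number of entries equal to `j` in row `i` of the `α`-tableau `T`. -/
def rowContent (α : Partition n) (T : ℕ × ℕ → ℕ) (i j : ℕ) : ℕ :=
  ((Finset.Icc 1 (α.parts i)).filter fun col => T (i, col) = j).card

open Classical in
/-- James' homomorphism `θ_T : M^α → M^c` attached to an `α`-tableau `T` of type `c`:
an `α`-tabloid `f` is sent to the sum of all `c`-tabloids `g` such that, for all `i`, `j`,
exactly `rowContent α T i j` symbols lie in row `i` of `f` and row `j` of `g`.  (This is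
the sum over the row-equivalence class of `T` of the corresponding tabloids.) -/
noncomputable def theta (R : Type*) [CommRing R] (α : Partition n) (c : ℕ → ℕ)
    (T : ℕ × ℕ → ℕ) : PermMod R n α.parts →ₗ[R] PermMod R n c :=
  Finsupp.lift (PermMod R n c) R (Tabloid n α.parts) fun f =>
    ∑ g ∈ Finset.univ.filter (fun g : Tabloid n c =>
        ∀ i j, (Finset.univ.filter fun k => f.1 k = i ∧ g.1 k = j).card = rowContent α T i j),
      Finsupp.single g (1 : R)

/-- The restriction `θ̂_T` of `θ_T` to the Specht module `S^α`. -/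
noncomputable def thetaHat (R : Type*) [CommRing R] (α : Partition n) (c : ℕ → ℕ)
    (T : ℕ × ℕ → ℕ) : ↥(Specht R α) →ₗ[R] PermMod R n c :=
  (theta R α c T).comp (Specht R α).subtype

/-- The composition `ν` obtained from `c` by replacing the rows `i`, `i+1` with rows of
sizes `c i + c (i+1) - r` and `r`. -/
def nuComp (c : ℕ → ℕ) (i r : ℕ) : ℕ → ℕ :=
  fun j => if j = i then c i + c (i + 1) - r else if j = i + 1 then r else c j

open Classical in
/-- James' homomorphism `ψ_{i,r} : M^c → M^ν`: a tabloid is sent to the sum of all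
tabloids obtained from it by changing all but `r` of the entries in row `i+1` to `i`. -/
noncomputable def psi (R : Type*) [CommRing R] (c : ℕ → ℕ) (i r : ℕ) :
    PermMod R n c →ₗ[R] PermMod R n (nuComp c i r) :=
  Finsupp.lift (PermMod R n (nuComp c i r)) R (Tabloid n c) fun f =>
    ∑ g ∈ Finset.univ.filter (fun g : Tabloid n (nuComp c i r) =>
        ∀ k, g.1 k = f.1 k ∨ (f.1 k = i + 1 ∧ g.1 k = i)),
      Finsupp.single g (1 : R)

/-- Normalized semistandard `α`-tableaux of type `c` (entries outside the diagram are `0`). -/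
def SSTSet (α : Partition n) (c : ℕ → ℕ) : Set (ℕ × ℕ → ℕ) :=
  {T | IsSemistandard α T ∧ IsTypeOf α c T ∧ ∀ cc, cc ∉ α.cells → T cc = 0}

lemma SSTSet_finite (α : Partition n) (c : ℕ → ℕ) (hc : (Function.support c).Finite) :
    (SSTSet α c).Finite := by
  classical
  have hinj : Set.InjOn (fun T (cc : ↥(cellFinset α)) => T cc.1) (SSTSet α c) := by
    intro T hT S hS h
    funext cc
    by_cases hcc : cc ∈ α.cells
    · have hmem : cc ∈ cellFinset α := (Set.Finite.mem_toFinset _).mpr hcc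
      exact congrFun h ⟨cc, hmem⟩
    · rw [hT.2.2 cc hcc, hS.2.2 cc hcc]
  have himage : ((fun T (cc : ↥(cellFinset α)) => T cc.1) '' SSTSet α c) ⊆
      Set.univ.pi (fun _ : ↥(cellFinset α) => insert 0 (Function.support c)) := by
    rintro _ ⟨T, hT, rfl⟩
    intro cc _
    have h1 := hT.2.1 (T cc.1)
    have h2 : cc.1 ∈ (cellFinset α).filter fun d => T d = T cc.1 :=
      Finset.mem_filter.mpr ⟨cc.2, rfl⟩
    have h3 : 0 < c (T cc.1) := h1 ▸ Finset.card_pos.mpr ⟨cc.1, h2⟩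
    exact Set.mem_insert_iff.mpr (Or.inr (by
      simp only [Function.mem_support]
      omega))
  exact Set.Finite.of_finite_image
    (Set.Finite.subset (Set.Finite.pi fun _ => hc.insert 0) himage) hinj

/-- The finset of all (normalized) semistandard `α`-tableaux of type `β`. -/
noncomputable def sstFinset (α β : Partition n) : Finset (ℕ × ℕ → ℕ) :=
  (SSTSet_finite α β.parts β.finite_support).toFinset

/-- `T̂(u)`, the entry at the end of row `u` of `T`. -/
def hatOf (α : Partition n) (T : ℕ × ℕ → ℕ) (u : ℕ) : ℕ := T (u, α.parts u)

/-- The semistandard `α`-set `{T}` of `T`: those rows `u ∈ {a, …, b-1}` with `T̂(u) ≠ u`. -/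
def Tset (α : Partition n) (a b : ℕ) (T : ℕ × ℕ → ℕ) : Finset ℕ :=
  (Finset.Icc a (b - 1)).filter fun u => hatOf α T u ≠ u

/-- The removable set `{R}`: those rows `i ∈ {a, …, b-1}` such that `(i, α_i)` is a
removable node of `[α]`. -/
def Rset (α : Partition n) (a b : ℕ) : Finset ℕ :=
  (Finset.Icc a (b - 1)).filter fun i => α.parts (i + 1) < α.parts i

/-- The hook lengths `h_i` in the `(α_b + 1)`-th column of `[α]` (with `h_i = 0` for `i ≥ b`):
`h_i = α_i - α_b + b - i - 1`. -/
def hook (α : Partition n) (b i : ℕ) : ℤ :=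
  if i < b then (α.parts i : ℤ) - (α.parts b : ℤ) + (b : ℤ) - (i : ℤ) - 1 else 0

/-- `T̂⁻¹(v)`: the row `u ∈ {a, …, b-1}` with `T̂(u) = v`. -/
noncomputable def invHat (α : Partition n) (a b : ℕ) (T : ℕ × ℕ → ℕ) (v : ℕ) : ℕ :=
  sInf {u | a ≤ u ∧ u ≤ b - 1 ∧ hatOf α T u = v}

/-- The smallest element of `X` greater than `u`, or `b` if there is none. -/
noncomputable def nextIn (X : Finset ℕ) (b u : ℕ) : ℕ := sInf ({v | v ∈ X ∧ u < v} ∪ {b})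

/-- The bijection `T̂ : {a,…,b-1} → {a+1,…,b}` determined by a semistandard set `X`:
`T̂` maps each `u ∈ X` to the next element of `X ∪ {b}` above it, and fixes `u ∉ X`. -/
noncomputable def hatOfSet (X : Finset ℕ) (b u : ℕ) : ℕ :=
  if u ∈ X then nextIn X b u else u

open Classical in
/-- The (normalized) semistandard `α`-tableau of type `β` whose semistandard set is `X`:
every cell of row `i` contains `i`, except that for `a ≤ i ≤ b-1` the last cell of row `i`
contains `T̂(i)` (where `T̂` is the bijection determined by `X`). -/
noncomputable def tableauOfSet (α : Partition n) (a b : ℕ) (X : Finset ℕ) : ℕ × ℕ → ℕ :=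
  fun cc =>
    if cc ∈ α.cells then
      (if a ≤ cc.1 ∧ cc.1 ≤ b - 1 ∧ cc.2 = α.parts cc.1 then hatOfSet X b cc.1 else cc.1)
    else 0

/-- `X` is a semistandard `α`-set of type `β` (for the one-box shift from row `a` to row `b`):
`a ∈ X ⊆ {a, …, b-1}`, and `u ∈ X` together with `α_{u+1} = α_u` forces `u+1 ∈ X`. -/
def IsSSSet (α : Partition n) (a b : ℕ) (X : Finset ℕ) : Prop :=
  a ∈ X ∧ (∀ u ∈ X, a ≤ u ∧ u ≤ b - 1) ∧
    ∀ u ∈ X, α.parts (u + 1) = α.parts u → u + 1 ∈ X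

/-- The coefficient `(-1)^{|T|} ∏_{u ∈ {R}\{T}} h_u` of `θ̂_T` in the Carter-Payne
homomorphism. -/
noncomputable def cpCoeff (α : Partition n) (a b : ℕ) (T : ℕ × ℕ → ℕ) : ℤ :=
  (-1) ^ (Tset α a b T).card * ∏ u ∈ Rset α a b \ Tset α a b T, hook α b u

section helpers

variable {F : Type*} [Field F]

/-- Column-antisymmetrisation of a function on fillings. -/
noncomputable def colSum {α : Partition n} (t : Placement α) (L : (Fin n → ℕ) → F)
    (g : Fin n → ℕ) : F :=
  ∑ π ∈ colStab t, ((Equiv.Perm.sign π : ℤ) : F) * L (fun k => g (π k))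

lemma mem_colStab {α : Partition n} (t : Placement α) (π : Equiv.Perm (Fin n)) :
    π ∈ colStab t ↔ ∀ k, (t.pos (π k)).2 = (t.pos k).2 := by
  simp [colStab]

lemma colStab_mul {α : Partition n} (t : Placement α) {π σ : Equiv.Perm (Fin n)}
    (hπ : π ∈ colStab t) (hσ : σ ∈ colStab t) : π * σ ∈ colStab t := by
  rw [mem_colStab] at *
  intro k
  rw [Equiv.Perm.mul_apply, hπ, hσ]

lemma colStab_inv {α : Partition n} (t : Placement α) {π : Equiv.Perm (Fin n)}
    (hπ : π ∈ colStab t) : π⁻¹ ∈ colStab t := by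
  rw [mem_colStab] at *
  intro k
  have := hπ (π⁻¹ k)
  simpa using this.symm

lemma colStab_swap {α : Partition n} (t : Placement α) {x y : Fin n}
    (h : (t.pos x).2 = (t.pos y).2) : Equiv.swap x y ∈ colStab t := by
  rw [mem_colStab]
  intro k
  rcases eq_or_ne k x with rfl | hx
  · simp [h]
  · rcases eq_or_ne k y with rfl | hy
    · simp [h]
    · rw [Equiv.swap_apply_of_ne_of_ne hx hy]

lemma colSum_swap {α : Partition n} (t : Placement α) (L : (Fin n → ℕ) → F)
    (g : Fin n → ℕ) {x y : Fin n} (hxy : x ≠ y) (h : (t.pos x).2 = (t.pos y).2) :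
    colSum t L (fun k => g (Equiv.swap x y k)) = - colSum t L g := by
  unfold colSum
  rw [← Finset.sum_neg_distrib]
  refine Finset.sum_bij' (fun π _ => Equiv.swap x y * π) (fun π _ => Equiv.swap x y * π)
    ?_ ?_ ?_ ?_ ?_
  · intro π hπ; exact colStab_mul t (colStab_swap t h) hπ
  · intro π hπ; exact colStab_mul t (colStab_swap t h) hπ
  · intro π _; simp
  · intro π _; simp
  · intro π _
    simp [Equiv.Perm.sign_mul, Equiv.Perm.sign_swap hxy]

/-- The one-element Garnir relation. -/
lemma colSum_garnir {α : Partition n} (t : Placement α) (L : (Fin n → ℕ) → F)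
    (hL : ∀ (g : Fin n → ℕ) (x y : Fin n), (t.pos x).1 = (t.pos y).1 →
      L (fun k => g (Equiv.swap x y k)) = L g)
    (g : Fin n → ℕ) (x0 : Fin n) (c : ℕ) (hc0 : 0 < c) (hc : c < (t.pos x0).2) :
    ∑ q ∈ Finset.univ.filter (fun q => (t.pos q).2 = c),
      colSum t L (fun k => g (Equiv.swap x0 q k)) = colSum t L g := by
  classical
  -- the element of column c in the same row as p
  have hex : ∀ p : Fin n, ∃ q : Fin n, (t.pos p).2 = (t.pos x0).2 →
      t.pos q = ((t.pos p).1, c) := by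
    intro p
    by_cases hp : (t.pos p).2 = (t.pos x0).2
    · obtain ⟨h1, h2, h3⟩ := t.mem p
      obtain ⟨q, hq⟩ := t.surj ((t.pos p).1, c) ⟨h1, hc0, by simp only; omega⟩
      exact ⟨q, fun _ => hq⟩
    · exact ⟨p, fun h => absurd h hp⟩
  choose r hr using hex
  have hcolinv : ∀ π ∈ colStab t, (t.pos (π⁻¹ x0)).2 = (t.pos x0).2 := fun π hπ =>
    (mem_colStab t _).1 (colStab_inv t hπ) x0
  -- rewrite
  have key : ∀ q : Fin n, ∀ π : Equiv.Perm (Fin n),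
      (fun k => g (Equiv.swap x0 (π q) (π k))) =
        fun k => g (π (Equiv.swap (π⁻¹ x0) q k)) := by
    intro q π
    funext k
    congr 1
    have : π (Equiv.swap (π⁻¹ x0) q k) = Equiv.swap (π (π⁻¹ x0)) (π q) (π k) := by
      rw [Equiv.swap_apply_apply]; simp
    rw [this]; simp
  calc _ = ∑ π ∈ colStab t, ∑ q ∈ Finset.univ.filter (fun q => (t.pos q).2 = c),
        ((Equiv.Perm.sign π : ℤ) : F) * L (fun k => g (π (Equiv.swap (π⁻¹ x0) q k))) := by
        unfold colSum
        rw [Finset.sum_comm]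
        refine Finset.sum_congr rfl fun π hπ => ?_
        refine Finset.sum_bij' (fun q _ => π⁻¹ q) (fun q _ => π q) ?_ ?_ ?_ ?_ ?_
        · intro q hq
          simp only [Finset.mem_filter, Finset.mem_univ, true_and] at hq ⊢
          rw [(mem_colStab t _).1 (colStab_inv t hπ), hq]
        · intro q hq
          simp only [Finset.mem_filter, Finset.mem_univ, true_and] at hq ⊢
          rw [(mem_colStab t _).1 hπ, hq]
        · intro q _; simp
        · intro q _; simp
        · intro q _
          rw [← key]; simp
    _ = ∑ π ∈ colStab t, (((Equiv.Perm.sign π : ℤ) : F) * L (fun k => g (π k)) +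
          ∑ q ∈ (Finset.univ.filter (fun q => (t.pos q).2 = c)).erase (r (π⁻¹ x0)),
        ((Equiv.Perm.sign π : ℤ) : F) * L (fun k => g (π (Equiv.swap (π⁻¹ x0) q k)))) := by
        refine Finset.sum_congr rfl fun π hπ => ?_
        have h1 := hr (π⁻¹ x0) (hcolinv π hπ)
        have hm : r (π⁻¹ x0) ∈ Finset.univ.filter (fun q => (t.pos q).2 = c) := by
          rw [Finset.mem_filter, h1]; exact ⟨Finset.mem_univ _, rfl⟩
        rw [← Finset.add_sum_erase _ _ hm]
        congr 2
        exact hL (fun k => g (π k)) _ _ (by rw [h1])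
    _ = colSum t L g + ∑ x ∈ (colStab t).sigma (fun π =>
          (Finset.univ.filter (fun q => (t.pos q).2 = c)).erase (r (π⁻¹ x0))),
        ((Equiv.Perm.sign x.1 : ℤ) : F) *
          L (fun k => g (x.1 (Equiv.swap (x.1⁻¹ x0) x.2 k))) := by
        rw [Finset.sum_add_distrib, Finset.sum_sigma]
        rfl
    _ = colSum t L g + 0 := by
        congr 1
        have hinv : ∀ π ∈ colStab t, ∀ q, (t.pos q).2 = c →
            (π * Equiv.swap q (r (π⁻¹ x0)))⁻¹ x0 = π⁻¹ x0 := by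
          intro π hπ q hq
          have h1 := hr (π⁻¹ x0) (hcolinv π hπ)
          have h2 := hcolinv π hπ
          rw [mul_inv_rev, Equiv.Perm.mul_apply, Equiv.swap_inv]
          apply Equiv.swap_apply_of_ne_of_ne
          · intro h; rw [h] at h2; omega
          · intro h; rw [← h] at h1; rw [h1] at h2; simp only at h2; omega
        refine Finset.sum_involution
          (fun x _ => ⟨x.1 * Equiv.swap x.2 (r (x.1⁻¹ x0)), x.2⟩) ?_ ?_ ?_ ?_
        · rintro ⟨π, q⟩ hx
          simp only [Finset.mem_sigma, Finset.mem_erase, Finset.mem_filter, Finset.mem_univ,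
            true_and] at hx
          obtain ⟨hπ, hne, hq⟩ := hx
          simp only
          rw [hinv π hπ q hq]
          have h1 := hr (π⁻¹ x0) (hcolinv π hπ)
          have h2 := hcolinv π hπ
          rw [Equiv.Perm.sign_mul, Equiv.Perm.sign_swap hne]
          have e : (fun k => g ((π * Equiv.swap q (r (π⁻¹ x0)))
              (Equiv.swap (π⁻¹ x0) q k))) =
              fun k => (fun m => g (π (Equiv.swap (π⁻¹ x0) q m)))
                (Equiv.swap (π⁻¹ x0) (r (π⁻¹ x0)) k) := by
            funext k
            simp only [Equiv.Perm.mul_apply]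
            congr 2
            have hA : π⁻¹ x0 ≠ q := by intro h; rw [h] at h2; omega
            have hB : π⁻¹ x0 ≠ r (π⁻¹ x0) := by
              intro h; rw [← h] at h1; rw [h1] at h2; simp only at h2; omega
            generalize r (π⁻¹ x0) = z at *
            generalize π⁻¹ x0 = p at *
            simp only [Equiv.swap_apply_def]
            split_ifs <;> simp_all
          rw [e, hL (fun m => g (π (Equiv.swap (π⁻¹ x0) q m))) _ _ (by rw [h1])]
          push_cast
          ring
        · rintro ⟨π, q⟩ hx _ heq
          simp only [Finset.mem_sigma, Finset.mem_erase] at hx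
          have := congrArg Sigma.fst heq
          simp only [mul_eq_left] at this
          exact hx.2.1 (Equiv.swap_eq_one_iff.1 this)
        · rintro ⟨π, q⟩ hx
          simp only [Finset.mem_sigma, Finset.mem_erase, Finset.mem_filter, Finset.mem_univ,
            true_and] at hx ⊢
          obtain ⟨hπ, hne, hq⟩ := hx
          have h1 := hr (π⁻¹ x0) (hcolinv π hπ)
          refine ⟨colStab_mul t hπ (colStab_swap t (by rw [h1, hq])), ?_, hq⟩
          rw [hinv π hπ q hq]; exact hne
        · rintro ⟨π, q⟩ hx
          simp only [Finset.mem_sigma, Finset.mem_erase, Finset.mem_filter, Finset.mem_univ,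
            true_and] at hx
          obtain ⟨hπ, hne, hq⟩ := hx
          simp only
          rw [hinv π hπ q hq]
          simp [mul_assoc]
    _ = _ := by rw [add_zero]

/-- Constructor for tabloids. -/
def mkTab {c : ℕ → ℕ} (g : Fin n → ℕ)
    (h : ∀ i, (Finset.univ.filter fun k => g k = i).card = c i) : Tabloid n c := ⟨g, h⟩

/-- Extension by zero of an element of the permutation module. -/
noncomputable def extCoeff {c : ℕ → ℕ} (x : PermMod F n c) (g : Fin n → ℕ) : F :=
  open Classical in
  if h : ∀ i, (Finset.univ.filter fun k => g k = i).card = c i then x (mkTab g h) else 0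

lemma extCoeff_add {c : ℕ → ℕ} (x y : PermMod F n c) (g : Fin n → ℕ) :
    extCoeff (x + y) g = extCoeff x g + extCoeff y g := by
  unfold extCoeff; split_ifs <;> simp [Finsupp.add_apply]

lemma extCoeff_smul {c : ℕ → ℕ} (r : F) (x : PermMod F n c) (g : Fin n → ℕ) :
    extCoeff (r • x) g = r * extCoeff x g := by
  unfold extCoeff; split_ifs <;> simp [Finsupp.smul_apply]

lemma extCoeff_zero {c : ℕ → ℕ} (g : Fin n → ℕ) :
    extCoeff (0 : PermMod F n c) g = 0 := by
  unfold extCoeff; split_ifs <;> simp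

lemma extCoeff_sum {c : ℕ → ℕ} {ι : Type*} (s : Finset ι) (x : ι → PermMod F n c)
    (g : Fin n → ℕ) : extCoeff (∑ i ∈ s, x i) g = ∑ i ∈ s, extCoeff (x i) g := by
  classical
  induction s using Finset.induction_on with
  | empty => simp [extCoeff_zero]
  | insert i s hi ih => rw [Finset.sum_insert hi, Finset.sum_insert hi, extCoeff_add, ih]

open Classical in
lemma extCoeff_single {c : ℕ → ℕ} (f : Tabloid n c) (g : Fin n → ℕ) :
    extCoeff (Finsupp.single f (1 : F)) g = if f.1 = g then 1 else 0 := by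
  unfold extCoeff
  split_ifs with h1 h2 h2
  · have h3 : f = mkTab g h1 := Subtype.ext h2
    rw [Finsupp.single_apply, if_pos h3]
  · rw [Finsupp.single_apply, if_neg]
    intro h3; exact h2 (congrArg Subtype.val h3)
  · exact absurd (h2 ▸ f.2) h1
  · rfl

/-- Raising operators kill polytabloids. -/
lemma raise_polytabloid {β : Partition n} (s : Placement β) (h : Fin n → ℕ) {k l : ℕ}
    (hk : 0 < k) (hkl : k < l) :
    ∑ x ∈ Finset.univ.filter (fun x => h x = k),
      extCoeff (polytabloid F s) (Function.update h x l) = 0 := by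
  classical
  unfold polytabloid
  simp only [extCoeff_sum, extCoeff_smul, extCoeff_single, mul_ite, mul_one, mul_zero]
  simp only [← Finset.sum_filter]
  have e := Finset.sum_sigma (Finset.univ.filter (fun x => h x = k))
    (fun x => (colStab s).filter (fun π => (rowTabloid s π).1 = Function.update h x l))
    (fun z => ((Equiv.Perm.sign z.2 : ℤ) : F))
  rw [← e]
  have hex : ∀ z : (_ : Fin n) × Equiv.Perm (Fin n), ∃ y : Fin n,
      (s.pos (z.2 z.1)).1 = l → s.pos (z.2 y) = (k, (s.pos (z.2 z.1)).2) := by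
    intro z
    by_cases hl : (s.pos (z.2 z.1)).1 = l
    · obtain ⟨h1, h2, h3⟩ := s.mem (z.2 z.1)
      have := β.antitone hk hkl.le
      obtain ⟨q, hq⟩ := s.surj (k, (s.pos (z.2 z.1)).2) ⟨hk, h2, by
        simp only; rw [hl] at h3; omega⟩
      exact ⟨z.2⁻¹ q, fun _ => by simpa using hq⟩
    · exact ⟨z.1, fun h => absurd h hl⟩
  choose r hr using hex
  have facts : ∀ z ∈ (Finset.univ.filter (fun x => h x = k)).sigma
      (fun x => (colStab s).filter (fun π => (rowTabloid s π).1 = Function.update h x l)),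
      h z.1 = k ∧ z.2 ∈ colStab s ∧ (s.pos (z.2 z.1)).1 = l ∧
      s.pos (z.2 (r z)) = (k, (s.pos (z.2 z.1)).2) ∧ r z ≠ z.1 ∧ h (r z) = k ∧
      (∀ m, m ≠ z.1 → (s.pos (z.2 m)).1 = h m) := by
    rintro ⟨x, π⟩ hz
    simp only [Finset.mem_sigma, Finset.mem_filter, Finset.mem_univ, true_and] at hz
    obtain ⟨hx, hπ, hg⟩ := hz
    have hg' : ∀ m, (s.pos (π m)).1 = Function.update h x l m := fun m => congrFun hg m
    have h1 : (s.pos (π x)).1 = l := by rw [hg']; simp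
    have h2 := hr ⟨x, π⟩ h1
    simp only at h2
    have h3 : r ⟨x, π⟩ ≠ x := by
      intro hh; rw [hh] at h2; rw [h2] at h1; simp only at h1; omega
    have h4 : ∀ m, m ≠ x → (s.pos (π m)).1 = h m := by
      intro m hm; rw [hg', Function.update_of_ne hm]
    refine ⟨hx, hπ, h1, h2, h3, ?_, h4⟩
    rw [← h4 _ h3, h2]
  refine Finset.sum_involution (fun z _ => ⟨r z, z.2 * Equiv.swap z.1 (r z)⟩) ?_ ?_ ?_ ?_
  · intro z hz
    obtain ⟨f1, f2, f3, f4, f5, f6, f7⟩ := facts z hz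
    simp [Equiv.Perm.sign_mul, Equiv.Perm.sign_swap f5.symm]
  · intro z hz _ heq
    obtain ⟨f1, f2, f3, f4, f5, f6, f7⟩ := facts z hz
    exact f5 (congrArg Sigma.fst heq)
  · intro z hz
    obtain ⟨f1, f2, f3, f4, f5, f6, f7⟩ := facts z hz
    simp only [Finset.mem_sigma, Finset.mem_filter, Finset.mem_univ, true_and]
    refine ⟨f6, colStab_mul s f2 (colStab_swap s ?_), ?_⟩
    · have a1 := (mem_colStab s _).1 f2 z.1
      have a2 := (mem_colStab s _).1 f2 (r z)
      rw [f4] at a2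
      simp only at a2
      omega
    · funext m
      simp only [rowTabloid, Equiv.Perm.mul_apply]
      rcases eq_or_ne m (r z) with rfl | hm
      · simp [f3]
      · rw [Function.update_of_ne hm]
        rcases eq_or_ne m z.1 with rfl | hm'
        · simp [f4, f1]
        · rw [Equiv.swap_apply_of_ne_of_ne hm' hm, f7 m hm']
  · intro z hz
    obtain ⟨f1, f2, f3, f4, f5, f6, f7⟩ := facts z hz
    have e1 : (s.pos ((z.2 * Equiv.swap z.1 (r z)) (r z))).1 = l := by simp [f3]
    have h2 := hr ⟨r z, z.2 * Equiv.swap z.1 (r z)⟩ e1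
    have e3 : r ⟨r z, z.2 * Equiv.swap z.1 (r z)⟩ = z.1 := by
      have : s.pos ((z.2 * Equiv.swap z.1 (r z)) (r ⟨r z, z.2 * Equiv.swap z.1 (r z)⟩)) =
          s.pos ((z.2 * Equiv.swap z.1 (r z)) z.1) := by
        rw [h2]; simp [f4]
      exact (z.2 * Equiv.swap z.1 (r z)).injective (s.inj this)
    obtain ⟨x, π⟩ := z
    simp only at e3 ⊢
    rw [e3]
    simp [Equiv.swap_comm (r ⟨x, π⟩) x, mul_assoc]

lemma raise_specht {β : Partition n} (x : PermMod F n β.parts) (hx : x ∈ Specht F β)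
    (h : Fin n → ℕ) {k l : ℕ} (hk : 0 < k) (hkl : k < l) :
    ∑ m ∈ Finset.univ.filter (fun m => h m = k),
      extCoeff x (Function.update h m l) = 0 := by
  unfold Specht at hx
  induction hx using Submodule.span_induction with
  | mem x hx =>
    obtain ⟨s, rfl⟩ := hx
    exact raise_polytabloid s h hk hkl
  | zero => simp [extCoeff_zero]
  | add x y _ _ hx hy => simp [extCoeff_add, Finset.sum_add_distrib, hx, hy]
  | smul r x _ hx => simp [extCoeff_smul, ← Finset.mul_sum, hx]


lemma mem_cellFinset {μ : Partition n} (x : ℕ × ℕ) : x ∈ cellFinset μ ↔ x ∈ μ.cells := by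
  simp [cellFinset]

lemma cellFinset_row_card (μ : Partition n) (r : ℕ) :
    ((cellFinset μ).filter fun x => x.1 = r).card = μ.parts r := by
  have : (cellFinset μ).filter (fun x => x.1 = r) =
      (Finset.Icc 1 (μ.parts r)).image (fun c => (r, c)) := by
    ext ⟨u, v⟩
    simp only [Finset.mem_filter, mem_cellFinset, Finset.mem_image, Finset.mem_Icc, Prod.mk.injEq,
      Partition.cells, Set.mem_ofPred_eq]
    constructor
    · rintro ⟨⟨h1, h2, h3⟩, rfl⟩
      exact ⟨v, ⟨h2, h3⟩, rfl, rfl⟩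
    · rintro ⟨c, ⟨h1, h2⟩, rfl, rfl⟩
      refine ⟨⟨?_, h1, h2⟩, rfl⟩
      rcases Nat.eq_zero_or_pos r with rfl | h
      · rw [μ.parts_zero] at h2; omega
      · exact h
  rw [this, Finset.card_image_of_injective _ (fun x y h => by simpa using h)]
  simp

lemma cellFinset_card (μ : Partition n) : (cellFinset μ).card = n := by
  classical
  refine Eq.trans ?_ μ.sum_parts
  rw [finsum_eq_sum_of_support_subset (s := μ.finite_support.toFinset) _ (by simp)]
  rw [Finset.card_eq_sum_card_fiberwise (f := Prod.fst) (t := μ.finite_support.toFinset)]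
  · exact Finset.sum_congr rfl fun r _ => cellFinset_row_card μ r
  · intro x hx
    have hx' := (mem_cellFinset x).1 hx
    obtain ⟨h1, h2, h3⟩ := hx'
    simp only [Set.Finite.coe_toFinset, Function.mem_support]
    omega

lemma exists_placement (μ : Partition n) : Nonempty (Placement μ) := by
  let e := (cellFinset μ).equivFinOfCardEq (cellFinset_card μ)
  exact ⟨{
    pos := fun k => (e.symm k).1
    mem := fun k => (mem_cellFinset _).1 (e.symm k).2
    inj := fun x y h => e.symm.injective (Subtype.ext h)
    surj := fun c hc => ⟨e ⟨c, (mem_cellFinset c).2 hc⟩, by simp⟩ }⟩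

/-- The number of symbols in row `r` of `t` with value `c` under `g`. -/
def rowCt {α : Partition n} (t : Placement α) (g : Fin n → ℕ) (r c : ℕ) : ℕ :=
  (Finset.univ.filter fun k => (t.pos k).1 = r ∧ g k = c).card

open Classical in
/-- The total coefficient of semistandard tableaux row equivalent to `g`. -/
noncomputable def lamOf (α β : Partition n) (t : Placement α) (Λ : (ℕ × ℕ → ℕ) → F)
    (g : Fin n → ℕ) : F :=
  ∑ T ∈ sstFinset α β, if (∀ r c, rowCt t g r c = rowContent α T r c) then Λ T else 0

lemma lamOf_swap {α β : Partition n} (t : Placement α) (Λ : (ℕ × ℕ → ℕ) → F)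
    (g : Fin n → ℕ) (x y : Fin n) (h : (t.pos x).1 = (t.pos y).1) :
    lamOf α β t Λ (fun k => g (Equiv.swap x y k)) = lamOf α β t Λ g := by
  have : ∀ r c, rowCt t (fun k => g (Equiv.swap x y k)) r c = rowCt t g r c := by
    intro r c
    unfold rowCt
    refine Finset.card_equiv (Equiv.swap x y) fun k => ?_
    simp only [Finset.mem_filter, Finset.mem_univ, true_and]
    rcases eq_or_ne k x with rfl | hx
    · simp [h]
    · rcases eq_or_ne k y with rfl | hy
      · simp [h]
      · rw [Equiv.swap_apply_of_ne_of_ne hx hy]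
  have h2 : rowCt t (fun k => g (Equiv.swap x y k)) = rowCt t g :=
    funext fun r => funext fun c => this r c
  unfold lamOf
  rw [h2]

lemma rowCt_pos {α : Partition n} (t : Placement α) (G : ℕ × ℕ → ℕ) (r c : ℕ) :
    rowCt t (fun k => G (t.pos k)) r c = rowContent α G r c := by
  unfold rowCt rowContent
  refine Finset.card_bij (fun k _ => (t.pos k).2) ?_ ?_ ?_
  · intro k hk
    simp only [Finset.mem_filter, Finset.mem_univ, true_and, Finset.mem_Icc] at hk ⊢
    obtain ⟨h1, h2⟩ := hk
    obtain ⟨h3, h4, h5⟩ := t.mem k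
    subst h1
    exact ⟨⟨h4, h5⟩, h2⟩
  · intro k hk m hm h
    simp only [Finset.mem_filter, Finset.mem_univ, true_and] at hk hm
    exact t.inj (Prod.ext (hk.1.trans hm.1.symm) h)
  · intro d hd
    simp only [Finset.mem_filter, Finset.mem_Icc] at hd
    have hr : 0 < r := by
      rcases Nat.eq_zero_or_pos r with rfl | h
      · rw [α.parts_zero] at hd; omega
      · exact h
    obtain ⟨k, hk⟩ := t.surj (r, d) ⟨hr, hd.1.1, hd.1.2⟩
    exact ⟨k, by simp [hk, hd.2], by simp [hk]⟩

/-- number of cells with a value, via rows -/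
lemma rowContent_sum (α : Partition n) (T : ℕ × ℕ → ℕ) (t : Placement α) (c : ℕ) :
    ((cellFinset α).filter fun x => T x = c).card =
      (Finset.univ.filter fun k => T (t.pos k) = c).card := by
  symm
  refine Finset.card_bij (fun k _ => t.pos k) ?_ ?_ ?_
  · intro k hk
    simp only [Finset.mem_filter, Finset.mem_univ, true_and, mem_cellFinset] at hk ⊢
    exact ⟨t.mem k, hk⟩
  · intro k _ m _ h
    exact t.inj h
  · intro x hx
    simp only [Finset.mem_filter, mem_cellFinset] at hx
    obtain ⟨k, hk⟩ := t.surj x hx.1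
    exact ⟨k, by simp [hk, hx.2], hk⟩

lemma card_eq_of_rowCt {α : Partition n} (t : Placement α) (g g' : Fin n → ℕ)
    (h : ∀ r c, rowCt t g r c = rowCt t g' r c) (c : ℕ) :
    (Finset.univ.filter fun k => g k = c).card = (Finset.univ.filter fun k => g' k = c).card := by
  classical
  have key : ∀ g : Fin n → ℕ, (Finset.univ.filter fun k => g k = c).card =
      ∑ r ∈ Finset.univ.image (fun k => (t.pos k).1), rowCt t g r c := by
    intro g
    rw [Finset.card_eq_sum_card_fiberwise (f := fun k => (t.pos k).1)
      (t := Finset.univ.image (fun k => (t.pos k).1))]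
    · refine Finset.sum_congr rfl fun r _ => ?_
      unfold rowCt
      congr 1
      ext k
      simp [and_comm]
    · intro k _; simp
  rw [key, key]
  exact Finset.sum_congr rfl fun r _ => h r c

lemma mem_sst {α β : Partition n} {T : ℕ × ℕ → ℕ} :
    T ∈ sstFinset α β ↔ T ∈ SSTSet α β.parts := by
  simp [sstFinset]

lemma lamOf_eq_zero {α β : Partition n} (t : Placement α) (Λ : (ℕ × ℕ → ℕ) → F)
    (g : Fin n → ℕ)
    (hg : ¬ ∀ i, (Finset.univ.filter fun k => g k = i).card = β.parts i) :
    lamOf α β t Λ g = 0 := by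
  unfold lamOf
  refine Finset.sum_eq_zero fun T hT => ?_
  rw [if_neg]
  intro h
  apply hg
  intro i
  have h2 := (mem_sst.1 hT).2.1 i
  rw [rowContent_sum α T t] at h2
  rw [← h2]
  exact card_eq_of_rowCt t _ _ (fun r c => by rw [rowCt_pos, h]) i

lemma colSum_eq_zero {α β : Partition n} (t : Placement α) (Λ : (ℕ × ℕ → ℕ) → F)
    (g : Fin n → ℕ)
    (hg : ¬ ∀ i, (Finset.univ.filter fun k => g k = i).card = β.parts i) :
    colSum t (lamOf α β t Λ) g = 0 := by
  unfold colSum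
  refine Finset.sum_eq_zero fun π _ => ?_
  rw [lamOf_eq_zero, mul_zero]
  intro h
  apply hg
  intro i
  rw [← h i]
  exact (Finset.card_equiv π fun a => by simp).symm

open Classical in
lemma theta_single_apply {α β : Partition n} (T : ℕ × ℕ → ℕ) (f : Tabloid n α.parts)
    (g : Tabloid n β.parts) :
    theta F α β.parts T (Finsupp.single f 1) g =
      if (∀ i j, (Finset.univ.filter fun k => f.1 k = i ∧ g.1 k = j).card = rowContent α T i j)
        then 1 else 0 := by
  unfold theta
  simp only [Finsupp.lift_apply, Finsupp.sum_single_index, zero_smul, one_smul]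
  rw [Finsupp.finsetSum_apply]
  simp only [Finsupp.single_apply]
  rw [Finset.sum_ite_eq']
  simp

lemma theta_polytabloid {α β : Partition n} (t : Placement α) (Λ : (ℕ × ℕ → ℕ) → F)
    (g : Tabloid n β.parts) :
    (∑ T ∈ sstFinset α β, Λ T • theta F α β.parts T (polytabloid F t)) g =
      colSum t (lamOf α β t Λ) g.1 := by
  classical
  rw [Finsupp.finsetSum_apply]
  unfold polytabloid colSum lamOf
  simp only [map_sum, map_smul, Finset.mul_sum]
  rw [Finset.sum_comm]
  refine Finset.sum_congr rfl fun T _ => ?_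
  rw [Finsupp.smul_apply, Finsupp.finsetSum_apply, smul_eq_mul, Finset.mul_sum]
  refine Finset.sum_bij' (fun π _ => π⁻¹) (fun π _ => π⁻¹) (fun π h => colStab_inv t h)
    (fun π h => colStab_inv t h) (fun π _ => inv_inv π) (fun π _ => inv_inv π) ?_
  intro π _
  rw [Finsupp.smul_apply, theta_single_apply, smul_eq_mul, Equiv.Perm.sign_inv]
  have : ∀ i j, (Finset.univ.filter fun k => (rowTabloid t π).1 k = i ∧ g.1 k = j).card =
      rowCt t (fun k => g.1 (π⁻¹ k)) i j := by
    intro i j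
    unfold rowCt
    refine Finset.card_equiv π fun k => ?_
    rw [Finset.mem_filter, Finset.mem_filter]
    simp [rowTabloid]
  simp only [this]
  split_ifs
  · ring
  · ring

/-- The raising relation for the antisymmetrised coefficients. -/
lemma colSum_raise {α β : Partition n} (t : Placement α)
    (θ : ↥(Specht F α) →ₗ[F] PermMod F n β.parts)
    (hθ : θ ∈ SpechtHom F α β.parts (Specht F β))
    (Λ : (ℕ × ℕ → ℕ) → F)
    (hΛ : θ = ∑ T ∈ sstFinset α β, Λ T • thetaHat F α β.parts T)
    (h : Fin n → ℕ) {k l : ℕ} (hk : 0 < k) (hkl : k < l) :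
    ∑ m ∈ Finset.univ.filter (fun m => h m = k),
      colSum t (lamOf α β t Λ) (Function.update h m l) = 0 := by
  classical
  have hmem : polytabloid F t ∈ Specht F α := Submodule.subset_span ⟨t, rfl⟩
  have h1 := hθ.1 ⟨_, hmem⟩
  have h2 := raise_specht _ h1 h hk hkl
  rw [← h2]
  refine Finset.sum_congr rfl fun m _ => ?_
  unfold extCoeff
  split_ifs with h3
  · rw [hΛ, LinearMap.sum_apply]
    exact (theta_polytabloid t Λ (mkTab _ h3)).symm
  · exact colSum_eq_zero t Λ _ h3

/-- Semistandard tableaux have entries at least the row number. -/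
lemma sst_le {α β : Partition n} {T : ℕ × ℕ → ℕ} (hT : T ∈ SSTSet α β.parts) :
    ∀ r c, (r, c) ∈ α.cells → r ≤ T (r, c) := by
  intro r
  induction r with
  | zero => intro c _; omega
  | succ r ih =>
    intro c hc
    obtain ⟨h1, h2, h3⟩ := hc
    rcases Nat.eq_zero_or_pos r with rfl | hr
    · by_contra hlt
      have h0 : T (0 + 1, c) = 0 := by omega
      have := hT.2.1 0
      rw [β.parts_zero, Finset.card_eq_zero, Finset.filter_eq_empty_iff] at this
      exact this ((mem_cellFinset (0 + 1, c)).2 ⟨h1, h2, h3⟩) h0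
    · have hc' : (r, c) ∈ α.cells := ⟨hr, h2, le_trans h3 (α.antitone hr (by simp))⟩
      have := hT.1.2 r (r + 1) c hc' ⟨h1, h2, h3⟩ (by omega)
      have := ih c hc'
      omega

/-- Evaluation on fillings that are the identity off the bottoms of the columns. -/
lemma colSum_eval {α β : Partition n} (t : Placement α) (Λ : (ℕ × ℕ → ℕ) → F)
    (g : Fin n → ℕ) (hg : ∀ k, ((t.pos k).1 + 1, (t.pos k).2) ∈ α.cells → g k = (t.pos k).1) :
    colSum t (lamOf α β t Λ) g = lamOf α β t Λ g := by
  unfold colSum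
  rw [Finset.sum_eq_single (1 : Equiv.Perm (Fin n))]
  · simp
  · intro π hπ hne
    have : lamOf α β t Λ (fun k => g (π k)) = 0 := by
      unfold lamOf
      refine Finset.sum_eq_zero fun T hT => ?_
      rw [if_neg]
      intro hh
      apply hne
      have hge : ∀ k, (t.pos k).1 ≤ (t.pos (π k)).1 := by
        intro k
        have hcol := (mem_colStab t π).1 hπ k
        by_contra hlt
        push Not at hlt
        have hb : ((t.pos (π k)).1 + 1, (t.pos (π k)).2) ∈ α.cells := by
          obtain ⟨a1, a2, a3⟩ := t.mem k
          obtain ⟨b1, b2, b3⟩ := t.mem (π k)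
          refine ⟨by simp, b2, ?_⟩
          simp only
          rw [hcol]
          exact le_trans a3 (α.antitone (by omega) (by omega))
        have hv := hg _ hb
        have h1 := hh (t.pos k).1 (g (π k))
        have h2 : 0 < rowCt t (fun k => g (π k)) (t.pos k).1 (g (π k)) := by
          unfold rowCt
          exact Finset.card_pos.2 ⟨k, by simp⟩
        rw [h1] at h2
        obtain ⟨d, hd⟩ := Finset.card_pos.1 h2
        simp only [Finset.mem_filter, Finset.mem_Icc] at hd
        have := sst_le (mem_sst.1 hT) (t.pos k).1 d ⟨(t.mem k).1, hd.1.1, hd.1.2⟩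
        omega
      have hsum : ∑ k, (t.pos k).1 = ∑ k, (t.pos (π k)).1 :=
        (Equiv.sum_comp π (fun k => (t.pos k).1)).symm
      have heq := (Finset.sum_eq_sum_iff_of_le (fun k _ => hge k)).1 hsum
      ext1 k
      apply t.inj
      exact Prod.ext (heq k (Finset.mem_univ _)).symm ((mem_colStab t π).1 hπ k)
    rw [this, mul_zero]
  · intro h
    exact absurd ((mem_colStab t 1).2 (fun k => rfl)) h

lemma mono_count {m : ℕ} (f : ℕ → ℕ)
    (hf : ∀ c d, 1 ≤ c → c ≤ d → d ≤ m → f c ≤ f d) (v c : ℕ) (hc : 1 ≤ c) (hcm : c ≤ m) :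
    f c ≤ v ↔ c ≤ ((Finset.Icc 1 m).filter fun d => f d ≤ v).card := by
  constructor
  · intro h
    calc c = (Finset.Icc 1 c).card := by simp
      _ ≤ _ := Finset.card_le_card (by
        intro d hd
        simp only [Finset.mem_Icc, Finset.mem_filter] at hd ⊢
        exact ⟨⟨hd.1, by omega⟩, (hf d c hd.1 hd.2 hcm).trans h⟩)
  · intro h
    by_contra hv
    have : ((Finset.Icc 1 m).filter fun d => f d ≤ v).card ≤ (Finset.Icc 1 (c - 1)).card :=
      Finset.card_le_card (by
        intro d hd
        simp only [Finset.mem_Icc, Finset.mem_filter] at hd ⊢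
        refine ⟨hd.1.1, ?_⟩
        by_contra hlt
        have := hf c d hc (by omega) hd.1.2
        omega)
    simp at this
    omega

lemma rowContent_le (α : Partition n) (T : ℕ × ℕ → ℕ) (r v : ℕ) :
    ((Finset.Icc 1 (α.parts r)).filter fun d => T (r, d) ≤ v).card =
      ∑ w ∈ Finset.range (v + 1), rowContent α T r w := by
  rw [Finset.card_eq_sum_card_fiberwise (f := fun d => T (r, d)) (t := Finset.range (v + 1))]
  · refine Finset.sum_congr rfl fun w hw => ?_
    unfold rowContent
    congr 1
    ext d
    simp only [Finset.mem_filter, Finset.mem_range] at hw ⊢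
    constructor
    · rintro ⟨⟨h1, h2⟩, h3⟩; exact ⟨h1, h3⟩
    · rintro ⟨h1, h3⟩; exact ⟨⟨h1, by omega⟩, h3⟩
  · intro d hd
    simp only [Finset.coe_filter, Set.mem_ofPred_eq, Finset.coe_range, Set.mem_Iio] at hd ⊢
    omega

lemma sst_unique {α β : Partition n} {T S : ℕ × ℕ → ℕ} (hT : T ∈ SSTSet α β.parts)
    (hS : S ∈ SSTSet α β.parts) (h : ∀ r c, rowContent α T r c = rowContent α S r c) :
    T = S := by
  funext ⟨r, c⟩
  by_cases hc : (r, c) ∈ α.cells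
  · obtain ⟨h1, h2, h3⟩ := hc
    simp only at h1 h2 h3
    have key : ∀ v, T (r, c) ≤ v ↔ S (r, c) ≤ v := by
      intro v
      rw [mono_count (m := α.parts r) (fun d => T (r, d))
          (fun c d x1 x2 x3 => hT.1.1 r c d ⟨h1, x1, x2.trans x3⟩ ⟨h1, x1.trans x2, x3⟩ x2)
          v c h2 h3,
        mono_count (m := α.parts r) (fun d => S (r, d))
          (fun c d x1 x2 x3 => hS.1.1 r c d ⟨h1, x1, x2.trans x3⟩ ⟨h1, x1.trans x2, x3⟩ x2)
          v c h2 h3, rowContent_le, rowContent_le]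
      simp only [h]
    exact le_antisymm ((key _).2 le_rfl) ((key _).1 le_rfl)
  · rw [hT.2.2 _ hc, hS.2.2 _ hc]

lemma lamOf_sst {α β : Partition n} (t : Placement α) (Λ : (ℕ × ℕ → ℕ) → F)
    (T : ℕ × ℕ → ℕ) (hT : T ∈ SSTSet α β.parts) :
    lamOf α β t Λ (fun k => T (t.pos k)) = Λ T := by
  unfold lamOf
  rw [Finset.sum_eq_single T]
  · rw [if_pos]
    intro r c
    rw [rowCt_pos]
  · intro S hS hne
    rw [if_neg]
    intro h
    apply hne
    refine sst_unique (mem_sst.1 hS) hT fun r c => ?_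
    rw [← h, rowCt_pos]
  · intro h
    exact absurd (mem_sst.2 hT) h


/-- Antisymmetrised coefficient of a filling of the diagram. -/
noncomputable def cellSum (α β : Partition n) (t : Placement α) (Λ : (ℕ × ℕ → ℕ) → F)
    (G : ℕ × ℕ → ℕ) : F :=
  colSum t (lamOf α β t Λ) (fun k => G (t.pos k))

lemma cellSum_swap {α β : Partition n} (t : Placement α) (Λ : (ℕ × ℕ → ℕ) → F)
    (G : ℕ × ℕ → ℕ) {x y : ℕ × ℕ} (hx : x ∈ α.cells) (hy : y ∈ α.cells) (hxy : x ≠ y)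
    (hcol : x.2 = y.2) :
    cellSum α β t Λ (fun z => G (Equiv.swap x y z)) = - cellSum α β t Λ G := by
  obtain ⟨kx, rfl⟩ := t.surj x hx
  obtain ⟨ky, rfl⟩ := t.surj y hy
  unfold cellSum
  rw [← colSum_swap t _ (fun k => G (t.pos k)) (fun h => hxy (by rw [h])) hcol]
  simp only [t.inj.swap_apply]

lemma cellSum_dup {α β : Partition n} (t : Placement α) (Λ : (ℕ × ℕ → ℕ) → F)
    (h2 : (2 : F) ≠ 0)
    (G : ℕ × ℕ → ℕ) {x y : ℕ × ℕ} (hx : x ∈ α.cells) (hy : y ∈ α.cells) (hxy : x ≠ y)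
    (hcol : x.2 = y.2) (hG : G x = G y) : cellSum α β t Λ G = 0 := by
  have h := cellSum_swap (β := β) t Λ G hx hy hxy hcol
  have e : (fun z => G (Equiv.swap x y z)) = G := by
    funext z
    rw [Equiv.swap_apply_def]
    split_ifs with h1 h3
    · rw [h1, hG]
    · rw [h3, hG]
    · rfl
  rw [e] at h
  have h3 : (2 : F) * cellSum α β t Λ G = 0 := by linear_combination h
  exact (mul_eq_zero.1 h3).resolve_left h2

lemma cellSum_garnir {α β : Partition n} (t : Placement α) (Λ : (ℕ × ℕ → ℕ) → F)
    (G : ℕ × ℕ → ℕ) {x : ℕ × ℕ} (hx : x ∈ α.cells) (c : ℕ) (hc0 : 0 < c) (hc : c < x.2) :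
    ∑ q ∈ (cellFinset α).filter (fun q => q.2 = c),
      cellSum α β t Λ (fun z => G (Equiv.swap x q z)) = cellSum α β t Λ G := by
  obtain ⟨kx, rfl⟩ := t.surj x hx
  have h := colSum_garnir t (lamOf α β t Λ) (lamOf_swap t Λ) (fun k => G (t.pos k)) kx c hc0 hc
  unfold cellSum
  rw [← h]
  symm
  refine Finset.sum_bij (fun k _ => t.pos k) ?_ ?_ ?_ ?_
  · intro k hk
    simp only [Finset.mem_filter, Finset.mem_univ, true_and, mem_cellFinset] at hk ⊢
    exact ⟨t.mem k, hk⟩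
  · intro k _ m _ hh
    exact t.inj hh
  · intro q hq
    simp only [Finset.mem_filter, mem_cellFinset] at hq
    obtain ⟨k, hk⟩ := t.surj q hq.1
    exact ⟨k, by simp [hk, hq.2], hk⟩
  · intro k _
    simp only [t.inj.swap_apply]

lemma cellSum_raise {α β : Partition n} (t : Placement α)
    (θ : ↥(Specht F α) →ₗ[F] PermMod F n β.parts)
    (hθ : θ ∈ SpechtHom F α β.parts (Specht F β))
    (Λ : (ℕ × ℕ → ℕ) → F)
    (hΛ : θ = ∑ T ∈ sstFinset α β, Λ T • thetaHat F α β.parts T)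
    (G : ℕ × ℕ → ℕ) {k l : ℕ} (hk : 0 < k) (hkl : k < l) :
    ∑ x ∈ (cellFinset α).filter (fun x => G x = k),
      cellSum α β t Λ (Function.update G x l) = 0 := by
  rw [← colSum_raise t θ hθ Λ hΛ (fun m => G (t.pos m)) hk hkl]
  symm
  refine Finset.sum_bij (fun k _ => t.pos k) ?_ ?_ ?_ ?_
  · intro k hk
    simp only [Finset.mem_filter, Finset.mem_univ, true_and, mem_cellFinset] at hk ⊢
    exact ⟨t.mem k, hk⟩
  · intro k _ m _ hh
    exact t.inj hh
  · intro q hq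
    simp only [Finset.mem_filter, mem_cellFinset] at hq
    obtain ⟨k, hk⟩ := t.surj q hq.1
    exact ⟨k, by simp [hk, hq.2], hk⟩
  · intro m _
    unfold cellSum
    congr 1
    funext k
    rcases eq_or_ne k m with rfl | hkm
    · simp
    · rw [Function.update_of_ne hkm, Function.update_of_ne (fun h => hkm (t.inj h))]

lemma nextIn_spec (X : Finset ℕ) {b u : ℕ} (hu : u < b) (hX : ∀ v ∈ X, v < b) :
    u < nextIn X b u ∧ nextIn X b u ≤ b ∧ (nextIn X b u ∈ X ∨ nextIn X b u = b) ∧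
      ∀ v ∈ X, u < v → nextIn X b u ≤ v := by
  have hne : ({v | v ∈ X ∧ u < v} ∪ {b} : Set ℕ).Nonempty := ⟨b, by simp⟩
  have h1 := Nat.sInf_mem hne
  have h2 : ∀ v ∈ ({v | v ∈ X ∧ u < v} ∪ {b} : Set ℕ), nextIn X b u ≤ v :=
    fun v hv => Nat.sInf_le hv
  change nextIn X b u ∈ _ at h1
  refine ⟨?_, h2 b (by simp), ?_, fun v hv huv => h2 v (Or.inl ⟨hv, huv⟩)⟩
  · rcases h1 with h1 | h1
    · exact h1.2
    · rw [h1]; exact hu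
  · rcases h1 with h1 | h1
    · exact Or.inl h1.1
    · exact Or.inr h1

lemma nextIn_eq (X : Finset ℕ) {b u w : ℕ} (hX : ∀ v ∈ X, v < b) (huw : u < w) (hwb : w ≤ b)
    (hw : w ∈ X ∨ w = b) (hmin : ∀ v ∈ X, u < v → w ≤ v) : nextIn X b u = w := by
  obtain ⟨h1, h2, h3, h4⟩ := nextIn_spec X (lt_of_lt_of_le huw hwb) hX
  apply le_antisymm
  · rcases hw with hw | hw
    · exact h4 w hw huw
    · rw [hw]; exact h2
  · rcases h3 with h3 | h3
    · exact hmin _ h3 h1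
    · rw [h3]; exact hwb

lemma exists_pred (X : Finset ℕ) {a b w : ℕ} (hX : ∀ v ∈ X, v < b) (haX : a ∈ X)
    (haw : a < w) (hwb : w ≤ b) (hw : w ∈ X ∨ w = b) :
    ∃ u ∈ X, u < w ∧ nextIn X b u = w := by
  have hne : (X.filter (· < w)).Nonempty := ⟨a, by simp [haX, haw]⟩
  have hm := Finset.max'_mem _ hne
  have hmax := fun v hv => Finset.le_max' (X.filter (· < w)) v hv
  set u := (X.filter (· < w)).max' hne
  simp only [Finset.mem_filter] at hm hmax
  refine ⟨u, hm.1, hm.2, nextIn_eq X hX hm.2 hwb hw ?_⟩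
  intro v hv huv
  by_contra hlt
  have := hmax v ⟨hv, by omega⟩
  omega

lemma nextIn_inj (X : Finset ℕ) {b u v : ℕ} (hX : ∀ v ∈ X, v < b) (hu : u ∈ X) (hv : v ∈ X)
    (h : nextIn X b u = nextIn X b v) : u = v := by
  have h1 := nextIn_spec X (hX u hu) hX
  have h2 := nextIn_spec X (hX v hv) hX
  rcases lt_trichotomy u v with hlt | heq | hlt
  · have := h1.2.2.2 v hv hlt; omega
  · exact heq
  · have := h2.2.2.2 u hu hlt; omega

lemma tab_apply (α : Partition n) {a b : ℕ} (X : Finset ℕ) (hX : ∀ u ∈ X, a ≤ u ∧ u ≤ b - 1)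
    {x : ℕ × ℕ} (hx : x ∈ α.cells) :
    tableauOfSet α a b X x =
      if x.1 ∈ X ∧ x.2 = α.parts x.1 then nextIn X b x.1 else x.1 := by
  unfold tableauOfSet hatOfSet
  rw [if_pos hx]
  by_cases h1 : x.1 ∈ X
  · have := hX _ h1
    by_cases h2 : x.2 = α.parts x.1
    · simp [h1, h2, this]
    · simp [h2]
  · simp [h1]

lemma tab_sst {α β : Partition n} {a b : ℕ} (hs : OneBoxShift α β a b) (X : Finset ℕ)
    (hX : X ⊆ Rset α a b) (haX : a ∈ X) : tableauOfSet α a b X ∈ SSTSet α β.parts := by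
  classical
  have hR : ∀ u ∈ X, (a ≤ u ∧ u ≤ b - 1) ∧ α.parts (u + 1) < α.parts u := by
    intro u hu
    have := hX hu
    simpa [Rset] using this
  have hX' : ∀ u ∈ X, a ≤ u ∧ u ≤ b - 1 := fun u hu => (hR u hu).1
  have hab := hs.a_lt_b
  have ha := hs.a_pos
  have hXb : ∀ u ∈ X, u < b := fun u hu => by have := hX' u hu; omega
  have hge : ∀ x ∈ α.cells, x.1 ≤ tableauOfSet α a b X x := by
    intro x hx
    rw [tab_apply α X hX' hx]
    split_ifs with h
    · exact (nextIn_spec X (hXb _ h.1) hXb).1.le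
    · exact le_rfl
  refine ⟨⟨?_, ?_⟩, ?_, ?_⟩
  · intro r c d hc hd hcd
    rcases eq_or_lt_of_le hcd with rfl | hlt
    · exact le_rfl
    · have : tableauOfSet α a b X (r, c) = r := by
        rw [tab_apply α X hX' hc, if_neg]
        rintro ⟨_, h2⟩
        have := hd.2.2
        simp only at h2 this
        omega
      rw [this]
      exact hge _ hd
  · intro r s c hr hs' hrs
    have : tableauOfSet α a b X (r, c) = r := by
      rw [tab_apply α X hX' hr, if_neg]
      rintro ⟨h1, h2⟩
      have h3 := hs'.2.2
      have h4 := (hR _ h1).2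
      have h5 := α.antitone (Nat.succ_pos r) hrs
      simp only [Nat.succ_eq_add_one] at h2 h3 h4 h5
      omega
    rw [this]
    exact lt_of_lt_of_le hrs (hge _ hs')
  · intro v
    set e : ℕ → ℕ × ℕ := fun u => (u, α.parts u) with he
    have hecell : ∀ u ∈ X, e u ∈ cellFinset α := by
      intro u hu
      rw [mem_cellFinset]
      have := hR u hu
      exact ⟨by simp only [he]; omega, by simp only [he]; omega, le_rfl⟩
    have hmemE : ∀ x, x ∈ X.image e ↔ x.1 ∈ X ∧ x.2 = α.parts x.1 := by
      rintro ⟨u, c⟩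
      simp only [he, Finset.mem_image, Prod.mk.injEq]
      constructor
      · rintro ⟨w, hw, rfl, rfl⟩; exact ⟨hw, rfl⟩
      · rintro ⟨h1, h2⟩; exact ⟨u, h1, rfl, h2.symm⟩
    have heinj : Function.Injective e := fun x y h => congrArg Prod.fst h
    have hsplit : (cellFinset α).filter (fun x => tableauOfSet α a b X x = v) =
        ((cellFinset α \ X.image e).filter fun x => x.1 = v) ∪
          ((X.filter fun u => nextIn X b u = v).image e) := by
      ext x
      simp only [Finset.mem_filter, Finset.mem_union, Finset.mem_sdiff, hmemE]
      constructor
      · rintro ⟨h1, h2⟩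
        rw [tab_apply α X hX' ((mem_cellFinset x).1 h1)] at h2
        split_ifs at h2 with h3
        · right
          exact Finset.mem_image.2 ⟨x.1, by simp [h3.1, h2], Prod.ext rfl h3.2.symm⟩
        · left; exact ⟨⟨h1, h3⟩, h2⟩
      · rintro (⟨⟨h1, h3⟩, h2⟩ | h)
        · refine ⟨h1, ?_⟩
          rw [tab_apply α X hX' ((mem_cellFinset x).1 h1), if_neg h3, h2]
        · obtain ⟨u, hu, rfl⟩ := Finset.mem_image.1 h
          simp only [Finset.mem_filter] at hu
          have hc := hecell u hu.1
          refine ⟨hc, ?_⟩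
          rw [tab_apply α X hX' ((mem_cellFinset _).1 hc), if_pos ⟨hu.1, rfl⟩]
          exact hu.2
    have hdisj : Disjoint ((cellFinset α \ X.image e).filter fun x => x.1 = v)
        ((X.filter fun u => nextIn X b u = v).image e) := by
      rw [Finset.disjoint_left]
      intro x hx hx'
      simp only [Finset.mem_filter, Finset.mem_sdiff] at hx
      exact hx.1.2 (Finset.image_subset_image (Finset.filter_subset _ _) hx')
    rw [hsplit, Finset.card_union_of_disjoint hdisj, Finset.card_image_of_injective _ heinj]
    have hA : ((cellFinset α \ X.image e).filter fun x => x.1 = v).card +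
        (if v ∈ X then 1 else 0) = α.parts v := by
      rw [← cellFinset_row_card α v]
      have h1 : (cellFinset α).filter (fun x => x.1 = v) =
          ((cellFinset α \ X.image e).filter fun x => x.1 = v) ∪
          ((X.filter fun u => u = v).image e) := by
        ext x
        simp only [Finset.mem_filter, Finset.mem_union, Finset.mem_sdiff, hmemE]
        constructor
        · rintro ⟨h1, h2⟩
          by_cases h3 : x.1 ∈ X ∧ x.2 = α.parts x.1
          · right
            exact Finset.mem_image.2 ⟨x.1, Finset.mem_filter.2 ⟨h3.1, h2⟩, Prod.ext rfl h3.2.symm⟩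
          · left; exact ⟨⟨h1, h3⟩, h2⟩
        · rintro (⟨⟨h1, h3⟩, h2⟩ | h)
          · exact ⟨h1, h2⟩
          · obtain ⟨u, hu, rfl⟩ := Finset.mem_image.1 h
            simp only [Finset.mem_filter] at hu
            exact ⟨hecell u hu.1, hu.2⟩
      have h2 : Disjoint ((cellFinset α \ X.image e).filter fun x => x.1 = v)
          ((X.filter fun u => u = v).image e) := by
        rw [Finset.disjoint_left]
        intro x hx hx'
        simp only [Finset.mem_filter, Finset.mem_sdiff] at hx
        exact hx.1.2 (Finset.image_subset_image (Finset.filter_subset _ _) hx')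
      rw [h1, Finset.card_union_of_disjoint h2, Finset.card_image_of_injective _ heinj,
        Finset.filter_eq']
      split_ifs <;> simp
    have hB : (X.filter fun u => nextIn X b u = v).card =
        if (v ∈ X ∧ v ≠ a) ∨ v = b then 1 else 0 := by
      split_ifs with h
      · have : ∃ u ∈ X, u < v ∧ nextIn X b u = v := by
          rcases h with h | h
          · have h1 := hX' v h.1
            exact exists_pred X hXb haX (by omega) (by omega) (Or.inl h.1)
          · exact exists_pred X hXb haX (by omega) (by omega) (Or.inr h)
        obtain ⟨u, hu, _, huv⟩ := this
        rw [Finset.card_eq_one]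
        refine ⟨u, ?_⟩
        ext w
        simp only [Finset.mem_filter, Finset.mem_singleton]
        constructor
        · rintro ⟨h1, h2⟩
          exact nextIn_inj X hXb h1 hu (h2.trans huv.symm)
        · rintro rfl; exact ⟨hu, huv⟩
      · rw [Finset.card_eq_zero, Finset.filter_eq_empty_iff]
        intro u hu huv
        obtain ⟨h1, h2, h3, h4⟩ := nextIn_spec X (hXb u hu) hXb
        rw [huv] at h1 h3
        have := hX' u hu
        apply h
        rcases h3 with h3 | h3
        · exact Or.inl ⟨h3, by omega⟩
        · exact Or.inr h3
    rw [hB]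
    have hbX : b ∉ X := fun h => absurd (hXb b h) (lt_irrefl b)
    have hrem := hs.rem
    rcases eq_or_ne v a with rfl | hva
    · rw [hs.at_a]
      rw [if_pos haX] at hA
      rw [if_neg (by simp; omega)]
      omega
    · rcases eq_or_ne v b with rfl | hvb
      · rw [hs.at_b]
        rw [if_neg hbX] at hA
        simp
        omega
      · rw [hs.elsewhere v hva hvb, ← hA]
        simp [hva, hvb]
  · intro x hx
    unfold tableauOfSet
    rw [if_neg hx]

lemma tab_erase {α : Partition n} {a b : ℕ} (N : Finset ℕ) (ha : 0 < a)
    (hN : ∀ u ∈ N, a ≤ u ∧ u < b ∧ α.parts (u + 1) < α.parts u) {z p : ℕ} (hz : z ∈ N)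
    (hp : p ∈ N) (hpz : nextIn N b p = z) :
    tableauOfSet α a b (N.erase z) =
      Function.update (Function.update (tableauOfSet α a b N) (p, α.parts p) (nextIn N b z))
        (z, α.parts z) z := by
  have hNb : ∀ u ∈ N, u < b := fun u hu => (hN u hu).2.1
  have hN1 : ∀ u ∈ N, a ≤ u ∧ u ≤ b - 1 := fun u hu => by have := hN u hu; omega
  have hN2 : ∀ u ∈ N.erase z, a ≤ u ∧ u ≤ b - 1 := fun u hu => hN1 u (Finset.mem_of_mem_erase hu)
  have hNb2 : ∀ u ∈ N.erase z, u < b := fun u hu => hNb u (Finset.mem_of_mem_erase hu)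
  have hcell : ∀ u ∈ N, (u, α.parts u) ∈ α.cells := fun u hu => by
    have := hN u hu
    exact ⟨by simp only; omega, by simp only; omega, le_rfl⟩
  have hpz' := nextIn_spec N (hNb p hp) hNb
  rw [hpz] at hpz'
  have hzs := nextIn_spec N (hNb z hz) hNb
  funext x
  by_cases hx : x ∈ α.cells
  · rw [tab_apply α _ hN2 hx]
    rcases eq_or_ne x (z, α.parts z) with rfl | hxz
    · simp
    · rw [Function.update_of_ne hxz]
      rcases eq_or_ne x (p, α.parts p) with rfl | hxp
      · have hpne : p ≠ z := by omega
        rw [if_pos ⟨Finset.mem_erase.2 ⟨hpne, hp⟩, rfl⟩, Function.update_self]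
        refine nextIn_eq _ hNb2 (by simp only; omega) hzs.2.1 ?_ ?_
        · rcases hzs.2.2.1 with h | h
          · exact Or.inl (Finset.mem_erase.2 ⟨by omega, h⟩)
          · exact Or.inr h
        · intro v hv hpv
          have hv' := Finset.mem_erase.1 hv
          have := hpz'.2.2.2 v hv'.2 hpv
          exact hzs.2.2.2 v hv'.2 (by omega)
      · rw [Function.update_of_ne hxp, tab_apply α _ hN1 hx]
        by_cases h : x.1 ∈ N ∧ x.2 = α.parts x.1
        · have h1 : x.1 ≠ z := fun h1 => hxz (Prod.ext h1 (by rw [h.2, h1]))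
          have h2 : x.1 ≠ p := fun h1 => hxp (Prod.ext h1 (by rw [h.2, h1]))
          rw [if_pos h, if_pos ⟨Finset.mem_erase.2 ⟨h1, h.1⟩, h.2⟩]
          have hs := nextIn_spec N (hNb _ h.1) hNb
          refine nextIn_eq _ hNb2 hs.1 hs.2.1 ?_ ?_
          · rcases hs.2.2.1 with h3 | h3
            · refine Or.inl (Finset.mem_erase.2 ⟨fun h4 => ?_, h3⟩)
              exact h2 (nextIn_inj N hNb h.1 hp (h4.trans hpz.symm))
            · exact Or.inr h3
          · intro v hv; exact hs.2.2.2 v (Finset.mem_of_mem_erase hv)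
        · rw [if_neg h, if_neg]
          rintro ⟨h1, h2⟩
          exact h ⟨Finset.mem_of_mem_erase h1, h2⟩
  · rw [Function.update_of_ne (fun h : x = (z, α.parts z) => hx (h ▸ hcell z hz)),
      Function.update_of_ne (fun h : x = (p, α.parts p) => hx (h ▸ hcell p hp))]
    unfold tableauOfSet
    rw [if_neg hx, if_neg hx]


lemma cellSum_eval {α β : Partition n} (t : Placement α) (Λ : (ℕ × ℕ → ℕ) → F)
    {a b : ℕ} (hs : OneBoxShift α β a b) (X : Finset ℕ)
    (hX : X ⊆ Rset α a b) (haX : a ∈ X) {r c d : ℕ} (hc : (r, c) ∈ α.cells)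
    (hd : (r, d) ∈ α.cells) (hcr : α.parts (r + 1) < c) (hdr : α.parts (r + 1) < d) :
    cellSum α β t Λ (fun z => tableauOfSet α a b X (Equiv.swap (r, c) (r, d) z)) =
      Λ (tableauOfSet α a b X) := by
  have hR : ∀ u ∈ X, (a ≤ u ∧ u ≤ b - 1) ∧ α.parts (u + 1) < α.parts u := by
    intro u hu
    have := hX hu
    simpa [Rset] using this
  obtain ⟨kc, hkc⟩ := t.surj _ hc
  obtain ⟨kd, hkd⟩ := t.surj _ hd
  rw [← lamOf_sst t Λ _ (tab_sst hs X hX haX)]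
  unfold cellSum
  rw [colSum_eval]
  · rw [← hkc, ← hkd]
    simp only [t.inj.swap_apply]
    exact lamOf_swap t Λ (fun k => tableauOfSet α a b X (t.pos k)) kc kd (by rw [hkc, hkd])
  · intro k hk
    have h1 : t.pos k ≠ (r, c) := by
      intro h; rw [h] at hk; have := hk.2.2; simp only at this; omega
    have h2 : t.pos k ≠ (r, d) := by
      intro h; rw [h] at hk; have := hk.2.2; simp only at this; omega
    beta_reduce
    rw [Equiv.swap_apply_of_ne_of_ne h1 h2, tab_apply α X (fun u hu => (hR u hu).1) (t.mem k),
      if_neg]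
    rintro ⟨h3, h4⟩
    have := (hR _ h3).2
    have := hk.2.2
    simp only at this
    omega

lemma sum_row (α : Partition n) (r : ℕ) (f : ℕ × ℕ → F) :
    ∑ x ∈ (cellFinset α).filter (fun x => x.1 = r), f x =
      ∑ d ∈ Finset.Icc 1 (α.parts r), f (r, d) := by
  symm
  refine Finset.sum_bij (fun d _ => (r, d)) ?_ ?_ ?_ ?_
  · intro d hd
    rw [Finset.mem_Icc] at hd
    rw [Finset.mem_filter, mem_cellFinset]
    refine ⟨⟨?_, hd.1, hd.2⟩, rfl⟩
    rcases Nat.eq_zero_or_pos r with h | h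
    · rw [h, α.parts_zero] at hd; omega
    · exact h
  · intro d _ e _ h
    exact congrArg Prod.snd h
  · rintro ⟨u, v⟩ hq
    rw [Finset.mem_filter, mem_cellFinset] at hq
    obtain ⟨⟨_, h1, h2⟩, rfl⟩ := hq
    exact ⟨v, Finset.mem_Icc.2 ⟨h1, h2⟩, rfl⟩
  · intro d _; rfl

lemma sum_col (α : Partition n) (l j : ℕ) (hl : 0 < l) (hj0 : 0 < j) (hj : l ≤ α.parts j)
    (hj1 : α.parts (j + 1) < l) (f : ℕ × ℕ → F) :
    ∑ x ∈ (cellFinset α).filter (fun x => x.2 = l), f x =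
      ∑ u ∈ Finset.Icc 1 j, f (u, l) := by
  symm
  refine Finset.sum_bij (fun u _ => (u, l)) ?_ ?_ ?_ ?_
  · intro u hu
    rw [Finset.mem_Icc] at hu
    rw [Finset.mem_filter, mem_cellFinset]
    exact ⟨⟨hu.1, hl, hj.trans (α.antitone hu.1 hu.2)⟩, rfl⟩
  · intro d _ e _ h
    exact congrArg Prod.fst h
  · rintro ⟨u, v⟩ hq
    rw [Finset.mem_filter, mem_cellFinset] at hq
    obtain ⟨⟨h0, h1, h2⟩, rfl⟩ := hq
    refine ⟨u, Finset.mem_Icc.2 ⟨h0, ?_⟩, rfl⟩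
    by_contra hlt
    have := α.antitone (Nat.succ_pos j) (show j + 1 ≤ u by omega)
    simp only [Nat.succ_eq_add_one] at this h2
    omega
  · intro d _; rfl

/-- Everything about the tableau `T` of the removable set `N` near the rows `i < j`. -/
lemma core_raise {α β : Partition n} (t : Placement α)
    (θ : ↥(Specht F α) →ₗ[F] PermMod F n β.parts)
    (hθ : θ ∈ SpechtHom F α β.parts (Specht F β))
    (Λ : (ℕ × ℕ → ℕ) → F)
    (hΛ : θ = ∑ T ∈ sstFinset α β, Λ T • thetaHat F α β.parts T)
    {a b : ℕ} (hs : OneBoxShift α β a b) (N : Finset ℕ)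
    (hNR : N ⊆ Rset α a b) (haN : a ∈ N) {i j : ℕ} (hiN : i ∈ N) (hj : nextIn N b i = j)
    (hadj : α.parts (i + 1) = α.parts j) (q : F)
    (hq : ∑ d ∈ Finset.Icc 1 (α.parts j), cellSum α β t Λ
      (Function.update (Function.update (tableauOfSet α a b N) (i, α.parts i) i) (i, d) j) = q) :
    ((α.parts i : F) - (α.parts j : F)) * Λ (tableauOfSet α a b N) + q +
      (if i = a then 0 else Λ (tableauOfSet α a b (N.erase i))) = 0 := by
  have ha := hs.a_pos
  have hN : ∀ u ∈ N, a ≤ u ∧ u < b ∧ α.parts (u + 1) < α.parts u := by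
    intro u hu
    have h1 := hNR hu
    have := hs.a_lt_b
    simp only [Rset, Finset.mem_filter, Finset.mem_Icc] at h1
    omega
  have hNb : ∀ u ∈ N, u < b := fun u hu => (hN u hu).2.1
  have hN1 : ∀ u ∈ N, a ≤ u ∧ u ≤ b - 1 := fun u hu => by have := hN u hu; omega
  have hi := hN i hiN
  have hcell : ∀ u ∈ N, (u, α.parts u) ∈ α.cells := fun u hu => by
    have := hN u hu
    exact ⟨by simp only; omega, by simp only; omega, le_rfl⟩
  have hij := nextIn_spec N hi.2.1 hNb
  rw [hj] at hij
  set T := tableauOfSet α a b N with hTdef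
  have hT := fun (x : ℕ × ℕ) (hx : x ∈ α.cells) => tab_apply α N hN1 hx
  rw [← hTdef] at hT
  have hTi : T (i, α.parts i) = j := by
    rw [hT _ (hcell i hiN), if_pos ⟨hiN, rfl⟩, hj]
  set h := Function.update T (i, α.parts i) i with hh
  have hraise := cellSum_raise t θ hθ Λ hΛ h (show 0 < i by omega) hij.1
  have hval : ∀ x ∈ α.cells, h x = i ↔ x.1 = i ∨
      (x.1 ∈ N ∧ x.2 = α.parts x.1 ∧ nextIn N b x.1 = i) := by
    intro x hx
    rcases eq_or_ne x (i, α.parts i) with rfl | hne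
    · simp [hh]
    · rw [hh, Function.update_of_ne hne, hT x hx]
      split_ifs with h1
      · have : x.1 ≠ i := fun h2 => hne (Prod.ext h2 (by rw [h1.2, h2]))
        simp [h1.1, h1.2.symm, this]
      · constructor
        · exact Or.inl
        · rintro (h2 | ⟨h2, h3, _⟩)
          · exact h2
          · exact absurd ⟨h2, h3⟩ h1
  -- the row sum
  have hrow : ∑ x ∈ (cellFinset α).filter (fun x => x.1 = i),
      cellSum α β t Λ (Function.update h x j) =
        ((α.parts i : F) - (α.parts j : F)) * Λ T + q := by
    rw [sum_row]
    have hsub : Finset.Icc 1 (α.parts i) =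
        Finset.Icc 1 (α.parts j) ∪ Finset.Ioc (α.parts j) (α.parts i) := by
      ext d; simp only [Finset.mem_Icc, Finset.mem_union, Finset.mem_Ioc]; omega
    have hdis : Disjoint (Finset.Icc 1 (α.parts j)) (Finset.Ioc (α.parts j) (α.parts i)) := by
      rw [Finset.disjoint_left]; intro d; simp only [Finset.mem_Icc, Finset.mem_Ioc]; omega
    rw [hsub, Finset.sum_union hdis, hq, add_comm]
    congr 1
    rw [Finset.sum_congr rfl (g := fun _ => Λ T)]
    · rw [Finset.sum_const, Nat.card_Ioc, nsmul_eq_mul, Nat.cast_sub (by omega)]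
    · intro d hd
      rw [Finset.mem_Ioc] at hd
      have hdc : (i, d) ∈ α.cells := ⟨by simp only; omega, by simp only; omega, hd.2⟩
      rw [← cellSum_eval t Λ hs N hNR haN (hcell i hiN) hdc (by omega) (by omega)]
      congr 1
      funext z
      rw [Equiv.swap_apply_def, ← hTdef]
      have hTd : d ≠ α.parts i → T (i, d) = i := by
        intro hne
        rw [hT _ hdc, if_neg]
        rintro ⟨_, h2⟩; exact hne h2
      by_cases h1 : z = (i, α.parts i)
      · rw [if_pos h1]
        by_cases h2 : d = α.parts i
        · rw [h1, h2, Function.update_self, hTi]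
        · rw [Function.update_of_ne, hTd h2, hh, h1, Function.update_self]
          rw [h1]; intro h3; exact h2 (congrArg Prod.snd h3).symm
      · rw [if_neg h1]
        by_cases h2 : z = (i, d)
        · rw [if_pos h2, h2, Function.update_self, hTi]
        · rw [if_neg h2, Function.update_of_ne h2, hh, Function.update_of_ne h1]
  rw [← hrow]
  by_cases hia : i = a
  · rw [if_pos hia, add_zero, ← hraise]
    refine Finset.sum_congr ?_ fun _ _ => rfl
    ext x
    simp only [Finset.mem_filter, mem_cellFinset]
    refine and_congr_right fun hx => ?_
    rw [hval x hx]
    constructor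
    · exact Or.inl
    · rintro (h1 | ⟨h1, _, h3⟩)
      · exact h1
      · have := nextIn_spec N (hNb _ h1) hNb
        have := hN _ h1
        omega
  · rw [if_neg hia]
    obtain ⟨p, hp, hpi, hpn⟩ := exists_pred N hNb haN (show a < i by omega) hi.2.1.le (Or.inl hiN)
    have herase := tab_erase (α := α) N ha hN hiN hp hpn
    have hset : (cellFinset α).filter (fun x => h x = i) =
        insert (p, α.parts p) ((cellFinset α).filter (fun x => x.1 = i)) := by
      ext x
      simp only [Finset.mem_filter, mem_cellFinset, Finset.mem_insert]
      constructor
      · rintro ⟨hx, h1⟩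
        rw [hval x hx] at h1
        rcases h1 with h1 | ⟨h1, h2, h3⟩
        · exact Or.inr ⟨hx, h1⟩
        · left
          have := nextIn_inj N hNb h1 hp (h3.trans hpn.symm)
          exact Prod.ext this (by rw [h2, this])
      · rintro (rfl | ⟨hx, h1⟩)
        · exact ⟨hcell p hp, (hval _ (hcell p hp)).2 (Or.inr ⟨hp, rfl, hpn⟩)⟩
        · exact ⟨hx, (hval x hx).2 (Or.inl h1)⟩
    rw [hset, Finset.sum_insert] at hraise
    · have hNi : N.erase i ⊆ Rset α a b := (Finset.erase_subset _ _).trans hNR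
      have haNi : a ∈ N.erase i := Finset.mem_erase.2 ⟨fun h => hia h.symm, haN⟩
      have hlast : cellSum α β t Λ (Function.update h (p, α.parts p) j) =
          Λ (tableauOfSet α a b (N.erase i)) := by
        rw [← cellSum_eval t Λ hs _ hNi haNi (hcell p hp) (hcell p hp) (hN p hp).2.2
          (hN p hp).2.2]
        congr 1
        funext z
        rw [Equiv.swap_self, Equiv.refl_apply, herase, hj, hh, Function.update_comm]
        intro h3; have := congrArg Prod.fst h3; simp only at this; omega
      rw [← hraise, hlast]
      ring
    · simp only [Finset.mem_filter]
      rintro ⟨_, h3⟩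
      omega

lemma cellSum_eval_self {α β : Partition n} (t : Placement α) (Λ : (ℕ × ℕ → ℕ) → F)
    {a b : ℕ} (hs : OneBoxShift α β a b) (X : Finset ℕ)
    (hX : X ⊆ Rset α a b) (haX : a ∈ X) :
    cellSum α β t Λ (tableauOfSet α a b X) = Λ (tableauOfSet α a b X) := by
  have ha := hX haX
  have h0 := hs.a_pos
  simp only [Rset, Finset.mem_filter] at ha
  have hc : (a, α.parts a) ∈ α.cells := ⟨h0, by simp only; omega, le_rfl⟩
  have := cellSum_eval t Λ hs X hX haX hc hc ha.2 ha.2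
  simpa using this

set_option maxHeartbeats 2000000 in
lemma core_lt {α β : Partition n} (t : Placement α)
    (θ : ↥(Specht F α) →ₗ[F] PermMod F n β.parts)
    (hθ : θ ∈ SpechtHom F α β.parts (Specht F β)) (h2 : (2 : F) ≠ 0)
    (Λ : (ℕ × ℕ → ℕ) → F)
    (hΛ : θ = ∑ T ∈ sstFinset α β, Λ T • thetaHat F α β.parts T)
    {a b : ℕ} (hs : OneBoxShift α β a b) (N : Finset ℕ)
    (hNR : N ⊆ Rset α a b) (haN : a ∈ N) {i j : ℕ} (hiN : i ∈ N) (hj : nextIn N b i = j)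
    (hadj : α.parts (i + 1) = α.parts j) (hjN : j ∈ N) :
    ∑ d ∈ Finset.Icc 1 (α.parts j), cellSum α β t Λ
      (Function.update (Function.update (tableauOfSet α a b N) (i, α.parts i) i) (i, d) j) =
      ((j : F) - (i : F)) * Λ (tableauOfSet α a b N) - Λ (tableauOfSet α a b (N.erase j)) := by
  have ha := hs.a_pos
  have hN : ∀ u ∈ N, a ≤ u ∧ u < b ∧ α.parts (u + 1) < α.parts u := by
    intro u hu
    have h1 := hNR hu
    have := hs.a_lt_b
    simp only [Rset, Finset.mem_filter, Finset.mem_Icc] at h1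
    omega
  have hNb : ∀ u ∈ N, u < b := fun u hu => (hN u hu).2.1
  have hN1 : ∀ u ∈ N, a ≤ u ∧ u ≤ b - 1 := fun u hu => by have := hN u hu; omega
  have hi := hN i hiN
  have hjj := hN j hjN
  have hcell : ∀ u ∈ N, (u, α.parts u) ∈ α.cells := fun u hu => by
    have := hN u hu
    exact ⟨by simp only; omega, by simp only; omega, le_rfl⟩
  have hij := nextIn_spec N hi.2.1 hNb
  rw [hj] at hij
  have hjy := nextIn_spec N hjj.2.1 hNb
  have herase := tab_erase (α := α) N ha hN hjN hiN hj
  have hTT := cellSum_eval_self t Λ hs N hNR haN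
  have hTE := cellSum_eval_self t Λ hs (N.erase j) ((Finset.erase_subset _ _).trans hNR)
    (Finset.mem_erase.2 ⟨by omega, haN⟩)
  rw [herase] at hTE ⊢
  set T := tableauOfSet α a b N with hTdef
  have hT := fun (x : ℕ × ℕ) (hx : x ∈ α.cells) => tab_apply α N hN1 hx
  rw [← hTdef] at hT
  set y := nextIn N b j with hy
  have hTi : T (i, α.parts i) = j := by
    rw [hT _ (hcell i hiN), if_pos ⟨hiN, rfl⟩, hj]
  have hTj : T (j, α.parts j) = y := by
    rw [hT _ (hcell j hjN), if_pos ⟨hjN, rfl⟩]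
  set l := α.parts j with hl
  set m := α.parts i with hm
  have hlm : l < m := by omega
  have hl0 : 0 < l := by omega
  have hpart : ∀ s, i < s → s ≤ j → α.parts s = l := by
    intro s h1 h3
    have := α.antitone (show 0 < i + 1 by omega) (show i + 1 ≤ s by omega)
    have := α.antitone (show 0 < s by omega) h3
    omega
  have hcl : ∀ u, 0 < u → u ≤ j → (u, l) ∈ α.cells := by
    intro u h1 h3
    exact ⟨h1, hl0, α.antitone h1 h3⟩
  have hTl : ∀ u, 0 < u → u < j → T (u, l) = u := by
    intro u h1 h3
    rw [hT _ (hcl u h1 h3.le), if_neg]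
    rintro ⟨h4, h5⟩
    have h6 := (hN u h4).2.2
    simp only at h5
    have := α.antitone (show 0 < u + 1 by omega) (show u + 1 ≤ j by omega)
    omega
  have hTm : ∀ u, 0 < u → u < i → T (u, m) = u := by
    intro u h1 h3
    have hc : (u, m) ∈ α.cells := ⟨h1, by simp only; omega, α.antitone h1 h3.le⟩
    rw [hT _ hc, if_neg]
    rintro ⟨h4, h5⟩
    have h6 := (hN u h4).2.2
    simp only at h5
    have := α.antitone (show 0 < u + 1 by omega) (show u + 1 ≤ i by omega)
    omega
  have hTd : ∀ s, i < s → s ≤ j → ∀ d, 0 < d → d < l → (s, d) ∈ α.cells ∧ T (s, d) = s := by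
    intro s h1 h3 d h4 h5
    have hp := hpart s h1 h3
    have hc : (s, d) ∈ α.cells := ⟨by simp only; omega, h4, by simp only; omega⟩
    refine ⟨hc, ?_⟩
    rw [hT _ hc, if_neg]
    rintro ⟨_, h6⟩
    simp only at h6
    omega
  have hxi := hcell i hiN
  rw [← hm] at hxi
  have hilc := hcl i (by omega) (by omega)
  have hjlc := hcl j (by omega) le_rfl
  -- the elements `H_s`
  set B := Function.update (Function.update T (j, l) j) (i, m) i with hB
  set H : ℕ → ℕ × ℕ → ℕ := fun s => Function.update (Function.update B (s, l) y) (i, m) s with hH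
  have hP : ∀ s, i < s → s ≤ j → cellSum α β t Λ (H s) = Λ T := by
    intro s h1 h3
    rcases eq_or_lt_of_le h3 with rfl | hsj
    · rw [← hTT]
      congr 1
      funext z
      simp only [hH, hB, Function.update_apply]
      grind
    · have hps := hpart s h1 h3
      have hr := cellSum_raise t θ hθ Λ hΛ (Function.update T (i, m) s) (show 0 < s by omega) hsj
      have hsN : s ∉ N := fun h => by have := hij.2.2.2 s h h1; omega
      have hslc := hcl s (by omega) h3
      have hset : (cellFinset α).filter (fun x => Function.update T (i, m) s x = s) =
          insert (i, m) ((cellFinset α).filter (fun x => x.1 = s)) := by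
        ext x
        simp only [Finset.mem_filter, mem_cellFinset, Finset.mem_insert]
        rcases eq_or_ne x (i, m) with rfl | hne
        · simp [hxi]
        · rw [Function.update_of_ne hne]
          simp only [hne, false_or]
          refine and_congr_right fun hx => ?_
          rw [hT x hx]
          split_ifs with h4
          · constructor
            · intro h5
              have := (nextIn_spec N (hNb _ h4.1) hNb).2.2.1
              rw [h5] at this
              rcases this with h6 | h6
              · exact absurd h6 hsN
              · omega
            · intro h5
              rw [h5] at h4
              exact absurd h4.1 hsN
          · rfl
      rw [hset, Finset.sum_insert, sum_row, hps, Finset.sum_eq_single l] at hr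
      · have e1 : Function.update (Function.update T (i, m) s) (i, m) j = T := by
          funext z
          simp only [Function.update_apply]
          grind
        have e2 : Function.update (Function.update T (i, m) s) (s, l) j =
            fun z => H s (Equiv.swap (s, l) (j, l) z) := by
          funext z
          have := hTl s (by omega) hsj
          simp only [hH, hB, Function.update_apply, Equiv.swap_apply_def]
          grind
        rw [e1, e2, cellSum_swap t Λ (H s) hslc hjlc
          (fun h => by have := congrArg Prod.fst h; simp only at this; omega) rfl, hTT] at hr
        linear_combination -hr
      · intro d hd hdl
        rw [Finset.mem_Icc] at hd
        obtain ⟨hc1, hv1⟩ := hTd s h1 h3 d (by omega) (by omega)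
        obtain ⟨hc2, hv2⟩ := hTd j (by omega) le_rfl d (by omega) (by omega)
        refine cellSum_dup t Λ h2 _ hc1 hc2
          (fun h => by have := congrArg Prod.fst h; simp only at this; omega) rfl ?_
        simp only [Function.update_apply]
        grind
      · intro h; exact absurd (Finset.mem_Icc.2 ⟨hl0, le_rfl⟩) h
      · simp only [Finset.mem_filter]
        rintro ⟨_, h4⟩
        omega
  -- the Garnir relation
  set G := Function.update B (i, l) y with hG
  have hgar := cellSum_garnir (β := β) t Λ G hxi l hl0 hlm
  rw [sum_col α l j hl0 (by omega) hl.le hjj.2.2] at hgar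
  have hsplit : Finset.Icc 1 j = insert i (Finset.Ico 1 i ∪ Finset.Ioc i j) := by
    ext u; simp only [Finset.mem_Icc, Finset.mem_insert, Finset.mem_union, Finset.mem_Ico,
      Finset.mem_Ioc]; omega
  rw [hsplit, Finset.sum_insert (by simp), Finset.sum_union (by
    rw [Finset.disjoint_left]; intro u; simp only [Finset.mem_Ico, Finset.mem_Ioc]; omega)] at hgar
  have g1 : cellSum α β t Λ (fun z => G (Equiv.swap (i, m) (i, l) z)) =
      Λ (Function.update (Function.update T (i, m) y) (j, l) j) := by
    rw [← hTE]
    congr 1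
    funext z
    have := hTl i (by omega) hij.1
    simp only [hG, hB, Function.update_apply, Equiv.swap_apply_def]
    grind
  have g2 : ∑ u ∈ Finset.Ico 1 i, cellSum α β t Λ (fun z => G (Equiv.swap (i, m) (u, l) z)) = 0 := by
    refine Finset.sum_eq_zero fun u hu => ?_
    rw [Finset.mem_Ico] at hu
    have hc : (u, m) ∈ α.cells := ⟨hu.1, by simp only; omega, α.antitone hu.1 hu.2.le⟩
    refine cellSum_dup t Λ h2 _ hxi hc
      (fun h => by have := congrArg Prod.fst h; simp only at this; omega) rfl ?_
    have := hTl u (by omega) (by omega)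
    have := hTm u (by omega) (by omega)
    simp only [hG, hB, Function.update_apply, Equiv.swap_apply_def]
    grind
  have g3 : ∑ u ∈ Finset.Ioc i j, cellSum α β t Λ (fun z => G (Equiv.swap (i, m) (u, l) z)) =
      - (((j : F) - (i : F)) * Λ T) := by
    rw [Finset.sum_congr rfl (g := fun _ => - Λ T)]
    · rw [Finset.sum_const, Nat.card_Ioc, nsmul_eq_mul, Nat.cast_sub (by omega)]
      ring
    · intro s hsm
      rw [Finset.mem_Ioc] at hsm
      rw [← hP s hsm.1 hsm.2, ← cellSum_swap t Λ (H s) hilc (hcl s (by omega) hsm.2)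
        (fun h => by have := congrArg Prod.fst h; simp only at this; omega) rfl]
      congr 1
      funext z
      have := hTl i (by omega) hij.1
      have hs' : s < j → T (s, l) = s := fun h => hTl s (by omega) h
      simp only [hG, hB, hH, Function.update_apply, Equiv.swap_apply_def]
      grind
  rw [g1, g2, g3] at hgar
  rw [Finset.sum_eq_single l]
  · have e : Function.update (Function.update T (i, m) i) (i, l) j =
        fun z => G (Equiv.swap (i, l) (j, l) z) := by
      funext z
      have := hTl i (by omega) hij.1
      simp only [hG, hB, Function.update_apply, Equiv.swap_apply_def]
      grind
    rw [e, cellSum_swap t Λ G hilc hjlc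
      (fun h => by have := congrArg Prod.fst h; simp only at this; omega) rfl]
    linear_combination hgar
  · intro d hd hdl
    rw [Finset.mem_Icc] at hd
    have hc1 : (i, d) ∈ α.cells := ⟨by simp only; omega, hd.1, by simp only; omega⟩
    obtain ⟨hc2, hv2⟩ := hTd j (by omega) le_rfl d (by omega) (by omega)
    refine cellSum_dup t Λ h2 _ hc1 hc2
      (fun h => by have := congrArg Prod.fst h; simp only at this; omega) rfl ?_
    simp only [Function.update_apply]
    grind
  · intro h; exact absurd (Finset.mem_Icc.2 ⟨hl0, le_rfl⟩) h

end helpers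

/-- Let `F` be a field of characteristic `p > 2`, `β` a one-box-shift of
`α` (from row `a` to row `b`), and `θ̂ = Σ_T Λ_T θ̂_T : S^α → S^β` an
`FΣ_n`-homomorphism.  Let `{N}` be a removable `α`-set of type `β`, let `i ∈ {N}` and
`j = N̂(i)` be such that `(i, α_i)` and `(j, α_j)` are adjacent removable nodes of `[α]`.
Then `h_i Λ_{{N}} + Λ_{{N}∖{i}} = h_j Λ_{{N}} + Λ_{{N}∖{j}}`, where the term
`Λ_{{N}∖{i}}` is omitted if `i = a` and the term `Λ_{{N}∖{j}}` is omitted if `i = b-1`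
(so that `j = b`; recall `h_b = 0`). -/
theorem stmt14 (F : Type*) [Field F] (p : ℕ) [CharP F p] (hp : 2 < p)
    {n : ℕ} (α β : Partition n) (a b : ℕ) (hshift : OneBoxShift α β a b)
    (θ : ↥(Specht F α) →ₗ[F] PermMod F n β.parts)
    (hθ : θ ∈ SpechtHom F α β.parts (Specht F β))
    (Λ : (ℕ × ℕ → ℕ) → F)
    (hΛ : θ = ∑ T ∈ sstFinset α β, Λ T • thetaHat F α β.parts T)
    (N : Finset ℕ) (hNR : N ⊆ Rset α a b) (haN : a ∈ N)
    (i : ℕ) (hiN : i ∈ N) (j : ℕ) (hj : j = hatOfSet N b i)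
    (hadj : α.parts (i + 1) = α.parts j) :
    ((hook α b i : ℤ) : F) * Λ (tableauOfSet α a b N) +
        (if i = a then 0 else Λ (tableauOfSet α a b (N.erase i))) =
      ((hook α b j : ℤ) : F) * Λ (tableauOfSet α a b N) +
        (if j = b then 0 else Λ (tableauOfSet α a b (N.erase j))) := by
  have h2 : (2 : F) ≠ 0 := by
    intro h
    have h3 : ((2 : ℕ) : F) = 0 := by exact_mod_cast h
    rw [CharP.cast_eq_zero_iff F p] at h3
    have := Nat.le_of_dvd (by norm_num) h3
    omega
  obtain ⟨t⟩ := exists_placement α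
  have hab := hshift.a_lt_b
  have hN : ∀ u ∈ N, a ≤ u ∧ u < b ∧ α.parts (u + 1) < α.parts u := by
    intro u hu
    have h1 := hNR hu
    simp only [Rset, Finset.mem_filter, Finset.mem_Icc] at h1
    omega
  have hNb : ∀ u ∈ N, u < b := fun u hu => (hN u hu).2.1
  have hi := hN i hiN
  have hjn : nextIn N b i = j := by rw [hj, hatOfSet, if_pos hiN]
  have hsp := nextIn_spec N hi.2.1 hNb
  rw [hjn] at hsp
  by_cases hjb : j = b
  · have hib : i + 1 = b := by
      by_contra hne
      have h3 := α.antitone (show 0 < i + 1 by omega) (show i + 1 ≤ b - 1 by omega)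
      have h4 := hshift.add
      rw [hjb] at hadj
      omega
    have hq : ∑ d ∈ Finset.Icc 1 (α.parts j), cellSum α β t Λ
        (Function.update (Function.update (tableauOfSet α a b N) (i, α.parts i) i) (i, d) j)
          = 0 := by
      refine Finset.sum_eq_zero fun d hd => ?_
      rw [Finset.mem_Icc] at hd
      have hc1 : (i, d) ∈ α.cells := ⟨by have := hshift.a_pos; simp only; omega, hd.1,
        by simp only; omega⟩
      have hc2 : (j, d) ∈ α.cells := ⟨by simp only; omega, hd.1, hd.2⟩
      have hne : (j, d) ≠ (i, d) := by
        intro h; have := congrArg Prod.fst h; simp only at this; omega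
      have hne2 : (j, d) ≠ (i, α.parts i) := by
        intro h; have := congrArg Prod.fst h; simp only at this; omega
      refine cellSum_dup t Λ h2 _ hc1 hc2 hne.symm rfl ?_
      rw [Function.update_self, Function.update_of_ne hne, Function.update_of_ne hne2,
        tab_apply α N (fun u hu => by have := hN u hu; omega) hc2, if_neg]
      rintro ⟨h5, _⟩
      have := hNb _ h5
      simp only at this
      omega
    have h := core_raise t θ hθ Λ hΛ hshift N hNR haN hiN hjn hadj 0 hq
    rw [if_pos hjb]
    have e1 : hook α b i = (α.parts i : ℤ) - (α.parts j : ℤ) := by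
      rw [hook, if_pos hi.2.1, hjb, ← hib]; push_cast; ring
    have e2 : hook α b j = 0 := by rw [hook, if_neg (by omega)]
    rw [e1, e2]
    push_cast
    linear_combination h
  · have hjN : j ∈ N := hsp.2.2.1.resolve_right hjb
    have hq := core_lt t θ hθ h2 Λ hΛ hshift N hNR haN hiN hjn hadj hjN
    have h := core_raise t θ hθ Λ hΛ hshift N hNR haN hiN hjn hadj _ hq
    rw [if_neg hjb]
    rw [hook, if_pos hi.2.1, hook, if_pos (hNb j hjN)]
    push_cast
    linear_combination h

end CarterPayne
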